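/- Suppose φ : ℂ → ℝ is smooth, periodic and non-constant, that 0 < τ < max_E φ − min_E φ, and that ∇(Δφ)(z) ≠ 0 for every z with Δφ(z) = 0. Then there exists a unique continuous periodic ψ : ℂ → ℝ such that: (i) φ − τ ≤ ψ ≤ φ on ℂ; (ii) ψ is distributionally subharmonic on the open set {ψ > φ − τ}; (iii) ψ is distributionally superharmonic on the open set {ψ < φ}. Moreover this ψ is of class C^{1,1}, i.e. continuously differentiable with Lipschitz continuous gradient; the contact sets M₊(ψ) = {ψ = φ} and M₋(ψ) = {ψ = φ − τ} satisfy: L(M₊(ψ)∩E) > 0 and L(M₋(ψ)∩E) > 0; M₊(ψ) ⊆ {Δφ > 0} and M₋(ψ) ⊆ {Δφ < 0}; ∫_{M₊(ψ)∩E} Δφ(z) L(dz) = −∫_{M₋(ψ)∩E} Δφ(z) L(dz); and the free boundaries ∂M₊(ψ) and ∂M₋(ψ) have Lebesgue measure zero. -/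

import Mathlib

open MeasureTheory Real Complex

noncomputable section

/-- `f : ℂ → α` is 2π-periodic in both the real and the imaginary direction. -/
def PeriodicC {α : Type*} (f : ℂ → α) : Prop :=
  ∀ z : ℂ, f (z + (2 * Real.pi : ℝ)) = f z ∧ f (z + (2 * Real.pi : ℝ) * Complex.I) = f z

/-- The Cauchy–Riemann operator `∂̄ = (∂ₓ + i ∂_y)/2`. -/
noncomputable def dbar (u : ℂ → ℂ) (z : ℂ) : ℂ :=
  (fderiv ℝ u z 1 + Complex.I * fderiv ℝ u z Complex.I) / 2

/-- The Laplacian `Δ = ∂ₓ² + ∂_y²` of a real-valued function on `ℂ ≅ ℝ²`. -/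
noncomputable def lapC (f : ℂ → ℝ) (z : ℂ) : ℝ :=
  fderiv ℝ (fun w => fderiv ℝ f w 1) z 1 +
    fderiv ℝ (fun w => fderiv ℝ f w Complex.I) z Complex.I

/-- The fundamental domain `E = [0,2π) × [0,2π)`. -/
def Efd : Set ℂ :=
  {z : ℂ | z.re ∈ Set.Ico 0 (2 * Real.pi) ∧ z.im ∈ Set.Ico 0 (2 * Real.pi)}

/-- The squared weighted norm `‖u‖_{φ,h}² = ∫_E |u|² e^{-2φ/h}`. -/
noncomputable def wInt (φ : ℂ → ℝ) (h : ℝ) (u : ℂ → ℂ) : ℝ :=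
  ∫ z in Efd, ‖u z‖ ^ 2 * Real.exp (-2 * φ z / h)

/-- The counting function `N(t,h)`: the supremum of `dim V` over finite-dimensional
complex subspaces `V` of smooth periodic functions on which `‖h ∂̄ u‖_{φ,h} ≤ t ‖u‖_{φ,h}`. -/
noncomputable def countN (φ : ℂ → ℝ) (t h : ℝ) : ℕ :=
  sSup {n : ℕ | ∃ V : Submodule ℂ (ℂ → ℂ),
    Module.finrank ℂ V = n ∧
    (∀ u ∈ V, ContDiff ℝ (⊤ : ℕ∞) u ∧ PeriodicC u) ∧
    (∀ u ∈ V, wInt φ h (fun z => (h : ℂ) * dbar u z) ≤ t ^ 2 * wInt φ h u)}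

/-- `v` is distributionally subharmonic on the open set `U`. -/
def DSubhOn (v : ℂ → ℝ) (U : Set ℂ) : Prop :=
  ∀ χ : ℂ → ℝ, ContDiff ℝ (⊤ : ℕ∞) χ → HasCompactSupport χ → (∀ z, 0 ≤ χ z) →
    tsupport χ ⊆ U → 0 ≤ ∫ z : ℂ, v z * lapC χ z

/-- `v` is distributionally superharmonic on the open set `U`. -/
def DSuphOn (v : ℂ → ℝ) (U : Set ℂ) : Prop :=
  ∀ χ : ℂ → ℝ, ContDiff ℝ (⊤ : ℕ∞) χ → HasCompactSupport χ → (∀ z, 0 ≤ χ z) →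
    tsupport χ ⊆ U → (∫ z : ℂ, v z * lapC χ z) ≤ 0

/-! ### Periodic functions -/

/-- The lattice vector translating `z` into the fundamental domain. -/
def latticeShift (z : ℂ) : ℂ :=
  (-⌊z.re / (2 * Real.pi)⌋ : ℤ) * ((2 * Real.pi : ℝ) : ℂ) +
    (-⌊z.im / (2 * Real.pi)⌋ : ℤ) * ((2 * Real.pi : ℝ) * Complex.I)

theorem add_latticeShift_mem (z : ℂ) : z + latticeShift z ∈ Efd := by
  have h2 : (0 : ℝ) < 2 * Real.pi := by positivity
  have key : ∀ x : ℝ, x - ⌊x / (2 * Real.pi)⌋ * (2 * Real.pi) ∈ Set.Ico 0 (2 * Real.pi) := by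
    intro x
    have h1 := Int.floor_le (x / (2 * Real.pi))
    have h3 := Int.lt_floor_add_one (x / (2 * Real.pi))
    rw [le_div_iff₀ h2] at h1
    rw [div_lt_iff₀ h2] at h3
    constructor <;> linarith
  have hr : (z + latticeShift z).re = z.re - ⌊z.re / (2 * Real.pi)⌋ * (2 * Real.pi) := by
    simp [latticeShift]; ring
  have hi : (z + latticeShift z).im = z.im - ⌊z.im / (2 * Real.pi)⌋ * (2 * Real.pi) := by
    simp [latticeShift]; ring
  exact ⟨hr ▸ key z.re, hi ▸ key z.im⟩

theorem PeriodicC.add_latticeShift {α : Type*} {f : ℂ → α} (hf : PeriodicC f) (z w : ℂ) :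
    f (w + latticeShift z) = f w := by
  have h1 : Function.Periodic f ((2 * Real.pi : ℝ) : ℂ) := fun w => (hf w).1
  have h2 : Function.Periodic f ((2 * Real.pi : ℝ) * Complex.I) := fun w => (hf w).2
  rw [latticeShift, ← add_assoc]
  rw [(h2.int_mul _) _, (h1.int_mul _) _]

theorem PeriodicC.comp {α β : Type*} {f : ℂ → α} (hf : PeriodicC f) (g : α → β) :
    PeriodicC (fun z => g (f z)) :=
  fun z => ⟨congrArg g (hf z).1, congrArg g (hf z).2⟩

theorem PeriodicC.comp₂ {α β γ : Type*} {f : ℂ → α} {f' : ℂ → β} (hf : PeriodicC f)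
    (hf' : PeriodicC f') (g : α → β → γ) : PeriodicC (fun z => g (f z) (f' z)) :=
  fun z => ⟨congrArg₂ g (hf z).1 (hf' z).1, congrArg₂ g (hf z).2 (hf' z).2⟩

theorem PeriodicC.translate {α : Type*} {f : ℂ → α} (hf : PeriodicC f) (a : ℂ) :
    PeriodicC (fun z => f (z + a)) := by
  intro z
  constructor
  · exact (congrArg f (by ring)).trans (hf (z + a)).1
  · exact (congrArg f (by ring)).trans (hf (z + a)).2

/-- The closed fundamental square. -/
def closedSquare : Set ℂ := Set.Icc 0 (2 * Real.pi) ×ℂ Set.Icc 0 (2 * Real.pi)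

theorem isCompact_closedSquare : IsCompact closedSquare :=
  isCompact_Icc.reProdIm isCompact_Icc

theorem Efd_subset_closedSquare : Efd ⊆ closedSquare :=
  fun _ hz => ⟨Set.Ico_subset_Icc_self hz.1, Set.Ico_subset_Icc_self hz.2⟩

theorem PeriodicC.exists_isMaxOn {v : ℂ → ℝ} (hc : Continuous v) (hp : PeriodicC v) {S : Set ℂ}
    (hS : IsClosed S) (hSp : PeriodicC (fun z => z ∈ S)) (hne : S.Nonempty) :
    ∃ z ∈ S, ∀ y ∈ S, v y ≤ v z := by
  have hcp : IsCompact (S ∩ closedSquare) := isCompact_closedSquare.inter_left hS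
  have hmem : ∀ y ∈ S, y + latticeShift y ∈ S ∩ closedSquare := fun y hy =>
    ⟨(hSp.add_latticeShift y y).symm ▸ hy, Efd_subset_closedSquare (add_latticeShift_mem y)⟩
  obtain ⟨y, hy⟩ := hne
  obtain ⟨z, hz, hmax⟩ := hcp.exists_isMaxOn ⟨_, hmem y hy⟩ hc.continuousOn
  refine ⟨z, hz.1, fun y hy => ?_⟩
  rw [← hp.add_latticeShift y y]
  exact hmax (hmem y hy)

theorem PeriodicC.uniformContinuous {v : ℂ → ℝ} (hc : Continuous v) (hp : PeriodicC v) :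
    UniformContinuous v := by
  have hK : IsCompact (Metric.cthickening 1 closedSquare) := isCompact_closedSquare.cthickening
  have hu := hK.uniformContinuousOn_of_continuous hc.continuousOn
  rw [Metric.uniformContinuousOn_iff] at hu
  rw [Metric.uniformContinuous_iff]
  intro ε hε
  obtain ⟨δ, hδ, h⟩ := hu ε hε
  refine ⟨min δ 1, by positivity, fun a b hab => ?_⟩
  have ha : a + latticeShift a ∈ closedSquare := Efd_subset_closedSquare (add_latticeShift_mem a)
  rw [← hp.add_latticeShift a a, ← hp.add_latticeShift a b]
  apply h
  · exact Metric.self_subset_cthickening _ ha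
  · apply Metric.mem_cthickening_of_dist_le _ _ _ _ ha
    rw [dist_add_right, dist_comm]
    exact (hab.trans_le (min_le_right _ _)).le
  · rw [dist_add_right]
    exact hab.trans_le (min_le_left _ _)

theorem PeriodicC.exists_bound {E : Type*} [NormedAddCommGroup E] {v : ℂ → E} (hc : Continuous v)
    (hp : PeriodicC v) : ∃ C : ℝ, 0 ≤ C ∧ ∀ z, ‖v z‖ ≤ C := by
  obtain ⟨z, -, hz⟩ := (hp.comp (fun x => ‖x‖)).exists_isMaxOn hc.norm isClosed_univ
    (fun z => by simp) Set.univ_nonempty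
  exact ⟨‖v z‖, norm_nonneg _, fun y => hz y trivial⟩

theorem PeriodicC.fderiv {E : Type*} [NormedAddCommGroup E] [NormedSpace ℝ E] {f : ℂ → E}
    (hf : PeriodicC f) : PeriodicC (fderiv ℝ f) := by
  intro z
  constructor
  · rw [← fderiv_comp_add_right]; congr 1; funext w; exact (hf w).1
  · rw [← fderiv_comp_add_right]; congr 1; funext w; exact (hf w).2

theorem PeriodicC.lapC {f : ℂ → ℝ} (hf : PeriodicC f) : PeriodicC (lapC f) := by
  have h1 := (hf.fderiv.comp (fun L => L 1)).fderiv
  have h2 := (hf.fderiv.comp (fun L => L I)).fderiv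
  exact h1.comp₂ h2 (fun A B => A 1 + B I)

/-! ### The Laplacian -/

theorem lapC_eq_fderiv_fderiv {f : ℂ → ℝ} {z : ℂ} (hf : ContDiffAt ℝ 2 f z) :
    lapC f z = fderiv ℝ (fderiv ℝ f) z 1 1 + fderiv ℝ (fderiv ℝ f) z I I := by
  have hd : DifferentiableAt ℝ (fderiv ℝ f) z :=
    (hf.fderiv_right (m := 1) (by norm_num)).differentiableAt (by norm_num)
  have key : ∀ e : ℂ, fderiv ℝ (fun w => fderiv ℝ f w e) z e = fderiv ℝ (fderiv ℝ f) z e e := by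
    intro e
    rw [fderiv_clm_apply hd (differentiableAt_const e)]
    simp
  rw [lapC, key, key]

theorem lapC_add {f g : ℂ → ℝ} (hf : ContDiff ℝ 2 f) (hg : ContDiff ℝ 2 g) (z : ℂ) :
    lapC (fun w => f w + g w) z = lapC f z + lapC g z := by
  rw [lapC_eq_fderiv_fderiv (hf.add hg).contDiffAt, lapC_eq_fderiv_fderiv hf.contDiffAt,
    lapC_eq_fderiv_fderiv hg.contDiffAt]
  have h1 : fderiv ℝ (fun w => f w + g w) = fun w => fderiv ℝ f w + fderiv ℝ g w := by
    funext w
    exact fderiv_fun_add (hf.differentiable (by norm_num) w) (hg.differentiable (by norm_num) w)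
  rw [h1, fderiv_fun_add]
  · simp only [add_apply]; ring
  · exact (hf.fderiv_right (m := 1) (by norm_num)).differentiable (by norm_num) z
  · exact (hg.fderiv_right (m := 1) (by norm_num)).differentiable (by norm_num) z

theorem lapC_const_mul {f : ℂ → ℝ} (hf : ContDiff ℝ 2 f) (c : ℝ) (z : ℂ) :
    lapC (fun w => c * f w) z = c * lapC f z := by
  rw [lapC_eq_fderiv_fderiv (contDiff_const.mul hf).contDiffAt, lapC_eq_fderiv_fderiv hf.contDiffAt]
  have h1 : fderiv ℝ (fun w => c * f w) = fun w => c • fderiv ℝ f w := by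
    funext w
    exact fderiv_const_mul (hf.differentiable (by norm_num) w) c
  have hd : DifferentiableAt ℝ (fderiv ℝ f) z :=
    (hf.fderiv_right (m := 1) (by norm_num)).differentiable (by norm_num) z
  have h2 : fderiv ℝ (fun w => c • fderiv ℝ f w) z = c • fderiv ℝ (fderiv ℝ f) z :=
    (hd.hasFDerivAt.const_smul c).fderiv
  rw [h1, h2]
  simp only [smul_apply, smul_eq_mul]; ring

theorem lapC_neg {f : ℂ → ℝ} (z : ℂ) :
    lapC (fun w => -f w) z = -lapC f z := by
  simp only [lapC, fderiv_fun_neg, neg_apply]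
  ring

theorem lapC_comp_add_right (f : ℂ → ℝ) (a z : ℂ) :
    lapC (fun w => f (w + a)) z = lapC f (z + a) := by
  have h : ∀ w, fderiv ℝ (fun w => f (w + a)) w = fderiv ℝ f (w + a) := fun w =>
    fderiv_comp_add_right a
  simp only [lapC, h]
  rw [fderiv_comp_add_right (f := fun w => fderiv ℝ f w 1) a,
    fderiv_comp_add_right (f := fun w => fderiv ℝ f w I) a]

theorem lapC_comp_const_sub {f : ℂ → ℝ} (hf : ContDiff ℝ 2 f) (a z : ℂ) :
    lapC (fun w => f (a - w)) z = lapC f (a - z) := by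
  have h : ∀ g : ℂ → ℝ, Differentiable ℝ g → ∀ w e, fderiv ℝ (fun w => g (a - w)) w e =
      -fderiv ℝ g (a - w) e := by
    intro g hg w e
    have h1 : HasFDerivAt (fun w : ℂ => a - w) (-ContinuousLinearMap.id ℝ ℂ) w :=
      (hasFDerivAt_id w).const_sub a
    have h2 := ((hg (a - w)).hasFDerivAt.comp w h1).fderiv
    simp only [Function.comp_def] at h2
    rw [h2]; simp
  have hd : ∀ e : ℂ, Differentiable ℝ (fun w => fderiv ℝ f w e) := fun e =>
    ((hf.fderiv_right (m := 1) (by norm_num)).clm_apply contDiff_const).differentiable (by norm_num)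
  simp only [lapC, h f (hf.differentiable (by norm_num)), fderiv_fun_neg, neg_apply, h _ (hd _),
    neg_neg]

theorem lapC_congr_of_eventuallyEq {f g : ℂ → ℝ} {z : ℂ} (h : f =ᶠ[nhds z] g) :
    lapC f z = lapC g z := by
  have key : ∀ e : ℂ, (fun w => _root_.fderiv ℝ f w e) =ᶠ[nhds z]
      (fun w => _root_.fderiv ℝ g w e) := fun e =>
    (h.fderiv (𝕜 := ℝ)).mono fun w hw => by simp only [hw]
  simp only [lapC, (key 1).fderiv_eq, (key I).fderiv_eq]

theorem continuous_lapC {f : ℂ → ℝ} (hf : ContDiff ℝ 2 f) : Continuous (lapC f) := by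
  have h1 : Continuous (fderiv ℝ (fderiv ℝ f)) :=
    (hf.fderiv_right (m := 1) (by norm_num)).continuous_fderiv (by norm_num)
  have : lapC f = fun z => fderiv ℝ (fderiv ℝ f) z 1 1 + fderiv ℝ (fderiv ℝ f) z I I :=
    funext fun z => lapC_eq_fderiv_fderiv hf.contDiffAt
  rw [this]
  fun_prop

theorem contDiff_lapC {f : ℂ → ℝ} (hf : ContDiff ℝ (⊤ : ℕ∞) f) :
    ContDiff ℝ (⊤ : ℕ∞) (lapC f) := by
  have h1 : ∀ e : ℂ, ∀ g : ℂ → ℝ, ContDiff ℝ (⊤ : ℕ∞) g →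
      ContDiff ℝ (⊤ : ℕ∞) (fun w => fderiv ℝ g w e) := fun e g hg =>
    (hg.fderiv_right (m := (⊤ : ℕ∞)) (by simp)).clm_apply contDiff_const
  exact (h1 1 _ (h1 1 f hf)).add (h1 I _ (h1 I f hf))

theorem tsupport_lapC_subset (f : ℂ → ℝ) : tsupport (lapC f) ⊆ tsupport f := by
  apply closure_minimal _ (isClosed_tsupport f)
  intro z hz
  by_contra hn
  apply hz
  have h0 : f =ᶠ[nhds z] fun _ => 0 := notMem_tsupport_iff_eventuallyEq.mp hn
  rw [lapC_congr_of_eventuallyEq h0]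
  simp [lapC]

/-- Second derivatives along lines. -/
theorem deriv_deriv_line {f : ℂ → ℝ} {z : ℂ} (hf : ContDiff ℝ 2 f) (e : ℂ) :
    deriv (deriv (fun t : ℝ => f (z + t • e))) 0 = fderiv ℝ (fderiv ℝ f) z e e := by
  have hl : ∀ t : ℝ, HasDerivAt (fun t : ℝ => z + t • e) e t := fun t => by
    simpa using ((hasDerivAt_id t).smul_const e).const_add z
  have h1 : deriv (fun t : ℝ => f (z + t • e)) = fun t : ℝ => fderiv ℝ f (z + t • e) e := by
    funext t
    exact ((hf.differentiable (by norm_num) _).hasFDerivAt.comp_hasDerivAt t (hl t)).deriv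
  have hd : DifferentiableAt ℝ (fderiv ℝ f) z :=
    (hf.fderiv_right (m := 1) (by norm_num)).differentiable (by norm_num) _
  have h2 : HasFDerivAt (fun w => fderiv ℝ f w e) ((fderiv ℝ (fderiv ℝ f) z).flip e) z := by
    have := hd.hasFDerivAt.clm_apply (hasFDerivAt_const e z)
    simpa using this
  have h3 : HasDerivAt (fun t : ℝ => fderiv ℝ f (z + t • e) e)
      ((fderiv ℝ (fderiv ℝ f) z).flip e e) 0 :=
    HasFDerivAt.comp_hasDerivAt (l := fun w => fderiv ℝ f w e) (0 : ℝ) (by simpa using h2) (hl 0)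
  rw [h1, h3.deriv]
  rfl

theorem deriv_deriv_nonpos_of_isLocalMax {g : ℝ → ℝ} {x : ℝ} (hg : ContinuousAt g x)
    (h : IsLocalMax g x) : deriv (deriv g) x ≤ 0 := by
  by_contra! hpos
  have hmin := isLocalMin_of_deriv_deriv_pos hpos h.deriv_eq_zero hg
  have hconst : g =ᶠ[nhds x] fun _ => g x := by
    filter_upwards [h, hmin] with y h1 h2 using le_antisymm h1 h2
  have : deriv (deriv g) x = 0 := by
    rw [hconst.deriv.deriv_eq]; simp
  linarith

theorem fderiv_fderiv_nonpos_of_isLocalMax {f : ℂ → ℝ} {z : ℂ} (hf : ContDiff ℝ 2 f)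
    (h : IsLocalMax f z) (e : ℂ) : fderiv ℝ (fderiv ℝ f) z e e ≤ 0 := by
  rw [← deriv_deriv_line hf e]
  have hc : Continuous (fun t : ℝ => z + t • e) := by fun_prop
  apply deriv_deriv_nonpos_of_isLocalMax (hf.continuous.comp hc).continuousAt
  have ht : Filter.Tendsto (fun t : ℝ => z + t • e) (nhds 0) (nhds z) := by
    simpa using hc.tendsto 0
  filter_upwards [ht.eventually h] with t ht
  simpa using ht

theorem lapC_nonpos_of_isLocalMax {f : ℂ → ℝ} {z : ℂ} (hf : ContDiff ℝ 2 f)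
    (h : IsLocalMax f z) : lapC f z ≤ 0 := by
  rw [lapC_eq_fderiv_fderiv hf.contDiffAt]
  exact add_nonpos (fderiv_fderiv_nonpos_of_isLocalMax hf h 1)
    (fderiv_fderiv_nonpos_of_isLocalMax hf h I)

/-! ### Mollification -/

/-- Convolution of `v` with the kernel `k`. -/
def kconv (k v : ℂ → ℝ) (z : ℂ) : ℝ := ∫ t, k t * v (z - t)

/-- Mollification of `v` by the normalised bump function `ρ`. -/
def mol (ρ : ContDiffBump (0 : ℂ)) (v : ℂ → ℝ) : ℂ → ℝ := kconv (ρ.normed volume) v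

theorem kconv_eq_convolution (k v : ℂ → ℝ) :
    kconv k v = convolution k v (ContinuousLinearMap.lsmul ℝ ℝ) volume := by
  funext z
  simp [kconv, convolution_def]

theorem integrable_kernel_mul {k v : ℂ → ℝ} (hk : Continuous k) (hkc : HasCompactSupport k)
    (hv : Continuous v) (z : ℂ) : Integrable (fun t => k t * v (z - t)) :=
  (hk.mul (hv.comp (by fun_prop))).integrable_of_hasCompactSupport hkc.mul_right

theorem contDiff_kconv {k v : ℂ → ℝ} (hk : ContDiff ℝ (⊤ : ℕ∞) k) (hkc : HasCompactSupport k)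
    (hv : Continuous v) : ContDiff ℝ (⊤ : ℕ∞) (kconv k v) := by
  rw [kconv_eq_convolution]
  exact hkc.contDiff_convolution_left _ hk hv.locallyIntegrable

theorem fderiv_kconv {k v : ℂ → ℝ} (hk : ContDiff ℝ (⊤ : ℕ∞) k) (hkc : HasCompactSupport k)
    (hv : Continuous v) (z e : ℂ) :
    fderiv ℝ (kconv k v) z e = kconv (fun t => fderiv ℝ k t e) v z := by
  have hk1 : ContDiff ℝ 1 k := hk.of_le (by simp)
  have h := hkc.hasFDerivAt_convolution_left (ContinuousLinearMap.lsmul ℝ ℝ) (μ := volume)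
    hk1 hv.locallyIntegrable z
  rw [kconv_eq_convolution, h.fderiv, convolution_def, ContinuousLinearMap.integral_apply]
  · simp [kconv, ContinuousLinearMap.precompL_apply]
  · have := (hkc.fderiv (𝕜 := ℝ)).convolutionExists_left
      ((ContinuousLinearMap.lsmul ℝ ℝ).precompL ℂ) (μ := volume)
      (hk1.continuous_fderiv (by norm_num)) hv.locallyIntegrable z
    exact this

theorem lapC_kconv {k v : ℂ → ℝ} (hk : ContDiff ℝ (⊤ : ℕ∞) k) (hkc : HasCompactSupport k)
    (hv : Continuous v) (z : ℂ) : lapC (kconv k v) z = kconv (lapC k) v z := by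
  have hs : ∀ e : ℂ, ContDiff ℝ (⊤ : ℕ∞) (fun w => fderiv ℝ k w e) := fun e =>
    (hk.fderiv_right (m := (⊤ : ℕ∞)) (by simp)).clm_apply contDiff_const
  have hs' : ∀ e : ℂ, Continuous (fun w => fderiv ℝ (fun w => fderiv ℝ k w e) w e) := fun e =>
    (((hs e).fderiv_right (m := (⊤ : ℕ∞)) (by simp)).clm_apply contDiff_const).continuous
  have hc : ∀ e : ℂ, HasCompactSupport (fun w => fderiv ℝ k w e) := fun e =>
    hkc.fderiv_apply (𝕜 := ℝ) e
  have hc' : ∀ e : ℂ, HasCompactSupport (fun w => fderiv ℝ (fun w => fderiv ℝ k w e) w e) :=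
    fun e => (hc e).fderiv_apply (𝕜 := ℝ) e
  have h1 : ∀ e : ℂ, fderiv ℝ (fun w => fderiv ℝ (kconv k v) w e) z e =
      kconv (fun t => fderiv ℝ (fun w => fderiv ℝ k w e) t e) v z := by
    intro e
    simp only [fderiv_kconv hk hkc hv]
    exact fderiv_kconv (hs e) (hc e) hv z e
  rw [lapC, h1, h1]
  simp only [kconv]
  rw [← integral_add (integrable_kernel_mul (hs' 1) (hc' 1) hv z)
    (integrable_kernel_mul (hs' I) (hc' I) hv z)]
  simp only [lapC, add_mul]

section Mol

variable (ρ : ContDiffBump (0 : ℂ)) {v v' : ℂ → ℝ}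

theorem integrable_mol (hv : Continuous v) (z : ℂ) :
    Integrable (fun t => ρ.normed volume t * v (z - t)) :=
  integrable_kernel_mul ρ.continuous_normed ρ.hasCompactSupport_normed hv z

theorem contDiff_mol (hv : Continuous v) : ContDiff ℝ (⊤ : ℕ∞) (mol ρ v) :=
  contDiff_kconv ρ.contDiff_normed ρ.hasCompactSupport_normed hv

theorem contDiff_two_mol (hv : Continuous v) : ContDiff ℝ 2 (mol ρ v) :=
  (contDiff_mol ρ hv).of_le (WithTop.coe_le_coe.2 le_top : ((2 : ℕ∞) : WithTop ℕ∞) ≤ (⊤ : ℕ∞))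

theorem normed_eq_zero_of_lt {t : ℂ} (ht : ρ.rOut < ‖t‖) : ρ.normed volume t = 0 := by
  by_contra h
  have : t ∈ Function.support (ρ.normed volume) := h
  rw [ρ.support_normed_eq, mem_ball_zero_iff] at this
  linarith

theorem mol_mono {z z' : ℂ} (hv : Continuous v) (hv' : Continuous v')
    (h : ∀ t, ‖t‖ ≤ ρ.rOut → v (z - t) ≤ v' (z' - t)) : mol ρ v z ≤ mol ρ v' z' := by
  apply integral_mono (integrable_mol ρ hv z) (integrable_mol ρ hv' z')
  intro t
  by_cases ht : ‖t‖ ≤ ρ.rOut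
  · exact mul_le_mul_of_nonneg_left (h t ht) (ρ.nonneg_normed t)
  · simp [normed_eq_zero_of_lt ρ (not_le.mp ht)]

theorem mol_const (c : ℝ) (z : ℂ) : mol ρ (fun _ => c) z = c := by
  simp only [mol, kconv]
  rw [integral_mul_const, ρ.integral_normed, one_mul]

theorem mol_le {z : ℂ} {c : ℝ} (hv : Continuous v) (h : ∀ t, ‖t‖ ≤ ρ.rOut → v (z - t) ≤ c) :
    mol ρ v z ≤ c :=
  (mol_mono ρ hv continuous_const h).trans_eq (mol_const ρ c z)

theorem le_mol {z : ℂ} {c : ℝ} (hv : Continuous v) (h : ∀ t, ‖t‖ ≤ ρ.rOut → c ≤ v (z - t)) :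
    c ≤ mol ρ v z :=
  (mol_const ρ c z).symm.trans_le (mol_mono ρ continuous_const hv h)

theorem abs_mol_sub_le {z : ℂ} {c : ℝ} (hv : Continuous v)
    (h : ∀ t, ‖t‖ ≤ ρ.rOut → |v (z - t) - v z| ≤ c) : |mol ρ v z - v z| ≤ c := by
  rw [abs_sub_le_iff]
  constructor
  · have := mol_le ρ (c := v z + c) hv fun t ht => by linarith [(abs_le.mp (h t ht)).2]
    linarith
  · have := le_mol ρ (c := v z - c) hv fun t ht => by linarith [(abs_le.mp (h t ht)).1]
    linarith

theorem mol_congr {z : ℂ} (h : ∀ t, ‖t‖ ≤ ρ.rOut → v (z - t) = v' (z - t)) :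
    mol ρ v z = mol ρ v' z := by
  apply integral_congr_ae
  filter_upwards with t
  by_cases ht : ‖t‖ ≤ ρ.rOut
  · simp only [h t ht]
  · simp [normed_eq_zero_of_lt ρ (not_le.mp ht)]

theorem mol_neg (z : ℂ) : mol ρ (fun w => -v w) z = -mol ρ v z := by
  simp only [mol, kconv, mul_neg, integral_neg]

theorem mol_add (hv : Continuous v) (hv' : Continuous v') (z : ℂ) :
    mol ρ (fun w => v w + v' w) z = mol ρ v z + mol ρ v' z := by
  simp only [mol, kconv, mul_add]
  exact integral_add (integrable_mol ρ hv z) (integrable_mol ρ hv' z)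

theorem mol_const_mul (c : ℝ) (z : ℂ) : mol ρ (fun w => c * v w) z = c * mol ρ v z := by
  simp only [mol, kconv]
  rw [← integral_const_mul]
  congr 1; funext t; ring

theorem mol_translate (a z : ℂ) : mol ρ (fun w => v (w + a)) z = mol ρ v (z + a) := by
  simp only [mol, kconv]
  congr 1; funext t; congr 2; ring

theorem periodicC_mol (hv : PeriodicC v) : PeriodicC (mol ρ v) := by
  intro z
  rw [← mol_translate, ← mol_translate]
  exact ⟨mol_congr ρ fun t _ => (hv _).1, mol_congr ρ fun t _ => (hv _).2⟩

theorem lipschitzWith_mol {L : NNReal} (hv : LipschitzWith L v) : LipschitzWith L (mol ρ v) := by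
  apply LipschitzWith.of_le_add_mul
  intro x y
  have h := mol_mono ρ (z := x) (z' := y) (v' := fun w => v w + L * dist x y) hv.continuous
    (hv.continuous.add continuous_const) fun t _ => by
      have := hv.le_add_mul (x - t) (y - t)
      rwa [dist_sub_right] at this
  rwa [mol_add ρ hv.continuous continuous_const, mol_const] at h

theorem lapC_mol (hv : Continuous v) (z : ℂ) :
    lapC (mol ρ v) z = ∫ w, v w * lapC (fun w => ρ.normed volume (z - w)) w := by
  have h2 : ContDiff ℝ 2 (ρ.normed volume) := ρ.contDiff_normed (n := 2)
  rw [mol, lapC_kconv ρ.contDiff_normed ρ.hasCompactSupport_normed hv z, kconv]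
  rw [← integral_sub_left_eq_self _ volume z]
  congr 1; funext w
  rw [lapC_comp_const_sub h2, mul_comm, sub_sub_cancel]

theorem lapC_mol_nonneg (hv : Continuous v) {A : Set ℂ} (h : DSubhOn v A) {z : ℂ}
    (hz : Metric.closedBall z ρ.rOut ⊆ A) : 0 ≤ lapC (mol ρ v) z := by
  rw [lapC_mol ρ hv]
  have hsupp : Function.support (fun w => ρ.normed volume (z - w)) ⊆
      Metric.closedBall z ρ.rOut := by
    intro w hw
    by_contra hn
    apply hw
    apply normed_eq_zero_of_lt
    rwa [Metric.mem_closedBall, dist_comm, dist_eq_norm, not_le] at hn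
  have hts : tsupport (fun w => ρ.normed volume (z - w)) ⊆ Metric.closedBall z ρ.rOut :=
    closure_minimal hsupp Metric.isClosed_closedBall
  apply h
  · exact ρ.contDiff_normed.comp (contDiff_const.sub contDiff_id)
  · exact HasCompactSupport.of_support_subset_isCompact (isCompact_closedBall z ρ.rOut) hsupp
  · exact fun w => ρ.nonneg_normed _
  · exact hts.trans hz

end Mol

theorem exists_bump {ε : ℝ} (hε : 0 < ε) : ∃ ρ : ContDiffBump (0 : ℂ), ρ.rOut = ε :=
  ⟨⟨ε / 2, ε, by positivity, by linarith⟩, rfl⟩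

theorem exists_mol_close {v : ℂ → ℝ} (hv : UniformContinuous v) {η : ℝ} (hη : 0 < η) :
    ∃ δ > 0, ∀ ρ : ContDiffBump (0 : ℂ), ρ.rOut < δ → ∀ z, |mol ρ v z - v z| ≤ η := by
  obtain ⟨δ, hδ, h⟩ := Metric.uniformContinuous_iff.mp hv η hη
  refine ⟨δ, hδ, fun ρ hρ z => abs_mol_sub_le ρ hv.continuous fun t ht => ?_⟩
  rw [← Real.dist_eq]
  apply (h _).le
  rw [dist_eq_norm]
  simpa using ht.trans_lt hρ

/-! ### Calculus of distributional sub- and superharmonicity -/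

theorem integrable_mul_lapC {v χ : ℂ → ℝ} (hv : Continuous v) (hχ : ContDiff ℝ (⊤ : ℕ∞) χ)
    (hc : HasCompactSupport χ) : Integrable (fun z => v z * lapC χ z) := by
  refine (hv.mul (contDiff_lapC hχ).continuous).integrable_of_hasCompactSupport ?_
  exact (hc.mono' ((subset_tsupport _).trans (tsupport_lapC_subset χ))).mul_left

theorem DSubhOn.mono {v : ℂ → ℝ} {U V : Set ℂ} (h : DSubhOn v U) (hVU : V ⊆ U) : DSubhOn v V :=
  fun χ h1 h2 h3 h4 => h χ h1 h2 h3 (h4.trans hVU)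

theorem DSuphOn.neg {v : ℂ → ℝ} {U : Set ℂ} (h : DSuphOn v U) : DSubhOn (fun z => -v z) U := by
  intro χ h1 h2 h3 h4
  have := h χ h1 h2 h3 h4
  simp only [neg_mul, integral_neg]
  linarith

theorem DSubhOn.neg {v : ℂ → ℝ} {U : Set ℂ} (h : DSubhOn v U) : DSuphOn (fun z => -v z) U := by
  intro χ h1 h2 h3 h4
  have := h χ h1 h2 h3 h4
  simp only [neg_mul, integral_neg]
  linarith

theorem DSubhOn.add {v w : ℂ → ℝ} {U : Set ℂ} (hv : DSubhOn v U) (hw : DSubhOn w U)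
    (hvc : Continuous v) (hwc : Continuous w) : DSubhOn (fun z => v z + w z) U := by
  intro χ h1 h2 h3 h4
  simp only [add_mul]
  rw [integral_add (integrable_mul_lapC hvc h1 h2) (integrable_mul_lapC hwc h1 h2)]
  exact add_nonneg (hv χ h1 h2 h3 h4) (hw χ h1 h2 h3 h4)

theorem DSubhOn.const_mul {v : ℂ → ℝ} {U : Set ℂ} (hv : DSubhOn v U) {c : ℝ} (hc : 0 ≤ c) :
    DSubhOn (fun z => c * v z) U := by
  intro χ h1 h2 h3 h4
  simp only [mul_assoc]
  rw [integral_const_mul]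
  exact mul_nonneg hc (hv χ h1 h2 h3 h4)

theorem DSubhOn.translate {v : ℂ → ℝ} {U V : Set ℂ} (hv : DSubhOn v U) (a : ℂ)
    (hV : ∀ z ∈ V, z + a ∈ U) : DSubhOn (fun z => v (z + a)) V := by
  intro χ h1 h2 h3 h4
  have h5 := hv (fun z => χ (z + (-a))) (h1.comp (contDiff_id.add contDiff_const))
    (h2.comp_homeomorph (Homeomorph.addRight (-a))) (fun z => h3 _) ?_
  · rw [← integral_add_right_eq_self _ a] at h5
    simpa only [lapC_comp_add_right, add_neg_cancel_right] using h5
  · intro z hz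
    have : tsupport (fun z => χ (z + (-a))) = (fun z => z + (-a)) ⁻¹' tsupport χ :=
      tsupport_comp_eq_preimage χ (Homeomorph.addRight (-a))
    rw [this] at hz
    have := hV _ (h4 hz)
    simpa using this

/-! ### The weak maximum principle -/

theorem weak_max_principle {v b : ℂ → ℝ} {A : Set ℂ} (hA : IsOpen A) (hAb : Bornology.IsBounded A)
    (hv : UniformContinuous v) (hsub : DSubhOn v A) (hb : ContDiff ℝ 2 b)
    (hlap : ∀ z ∈ A, 0 < lapC b z) {m : ℝ} (hm : ∀ z ∈ frontier A, v z + b z ≤ m) :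
    ∀ z ∈ A, v z + b z ≤ m := by
  intro z₀ hz₀
  by_contra! hlt
  have hK : IsCompact (closure A) := hAb.isCompact_closure
  have hvc := hv.continuous
  have hbc := hb.continuous
  obtain ⟨z₁, hz₁, hmax⟩ := hK.exists_isMaxOn ⟨z₀, subset_closure hz₀⟩
    (hvc.add hbc).continuousOn
  set M := v z₁ + b z₁ with hM
  have hMm : m < M := hlt.trans_le (hmax (subset_closure hz₀))
  set S := {z | (M + m) / 2 ≤ v z + b z} ∩ closure A
  have hS : IsCompact S := hK.inter_left (isClosed_le continuous_const (hvc.add hbc))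
  have hSA : S ⊆ A := by
    rintro z ⟨h1, h2⟩
    by_contra hn
    have := hm z (hA.frontier_eq ▸ ⟨h2, hn⟩)
    simp only [Set.mem_ofPred_eq] at h1
    linarith
  obtain ⟨r, hr, hrA⟩ := hS.exists_cthickening_subset_open hA hSA
  obtain ⟨δ, hδ, hclose⟩ := exists_mol_close hv (η := (M - m) / 8) (by linarith)
  obtain ⟨ρ, hρ⟩ := exists_bump (ε := min r (δ / 2)) (by positivity)
  have hρδ : ρ.rOut < δ := by
    rw [hρ]; exact (min_le_right _ _).trans_lt (by linarith)
  have hf : ContDiff ℝ 2 (fun z => mol ρ v z + b z) := (contDiff_two_mol ρ hvc).add hb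
  obtain ⟨z₂, hz₂, hmax₂⟩ := hK.exists_isMaxOn ⟨z₀, subset_closure hz₀⟩ hf.continuous.continuousOn
  have h1 : mol ρ v z₁ + b z₁ ≤ mol ρ v z₂ + b z₂ := hmax₂ hz₁
  have h2 := abs_le.mp (hclose ρ hρδ z₁)
  have h3 := abs_le.mp (hclose ρ hρδ z₂)
  have hz₂S : z₂ ∈ S := ⟨by simp only [Set.mem_ofPred_eq]; linarith, hz₂⟩
  have hz₂A := hSA hz₂S
  have hloc : IsLocalMax (fun z => mol ρ v z + b z) z₂ := by
    filter_upwards [hA.mem_nhds hz₂A] with z hz using hmax₂ (subset_closure hz)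
  have h4 := lapC_nonpos_of_isLocalMax hf hloc
  rw [lapC_add (contDiff_two_mol ρ hvc) hb] at h4
  have h5 : 0 ≤ lapC (mol ρ v) z₂ := by
    apply lapC_mol_nonneg ρ hvc hsub
    refine Set.Subset.trans ?_ hrA
    refine (Metric.closedBall_subset_closedBall (hρ.trans_le (min_le_left _ _))).trans ?_
    exact Metric.closedBall_subset_cthickening hz₂S r
  linarith [hlap z₂ hz₂A]

/-! ### Polynomial barriers -/

theorem contDiff_sqDist (c : ℂ) {n : WithTop ℕ∞} :
    ContDiff ℝ n (fun z : ℂ => (z.re - c.re) ^ 2 + (z.im - c.im) ^ 2) := by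
  have h1 : ContDiff ℝ n Complex.re := Complex.reCLM.contDiff
  have h2 : ContDiff ℝ n Complex.im := Complex.imCLM.contDiff
  fun_prop

theorem sqDist_eq (z c : ℂ) : (z.re - c.re) ^ 2 + (z.im - c.im) ^ 2 = dist z c ^ 2 := by
  rw [dist_eq_norm, ← Complex.normSq_eq_norm_sq, Complex.normSq_apply]
  simp; ring

theorem lapC_sqDist (c z : ℂ) :
    lapC (fun z : ℂ => (z.re - c.re) ^ 2 + (z.im - c.im) ^ 2) z = 4 := by
  have hre : ∀ w : ℂ, HasFDerivAt (fun z : ℂ => z.re - c.re) Complex.reCLM w := fun w =>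
    Complex.reCLM.hasFDerivAt.sub_const _
  have him : ∀ w : ℂ, HasFDerivAt (fun z : ℂ => z.im - c.im) Complex.imCLM w := fun w =>
    Complex.imCLM.hasFDerivAt.sub_const _
  have h : ∀ w : ℂ, _ := fun w => (((hre w).pow 2).fun_add ((him w).pow 2)).fderiv
  have h1 : (fun w => fderiv ℝ (fun z : ℂ => (z.re - c.re) ^ 2 + (z.im - c.im) ^ 2) w 1) =
      fun w => 2 * (w.re - c.re) := by
    funext w; rw [h w]; simp
  have h2 : (fun w => fderiv ℝ (fun z : ℂ => (z.re - c.re) ^ 2 + (z.im - c.im) ^ 2) w I) =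
      fun w => 2 * (w.im - c.im) := by
    funext w; rw [h w]; simp
  rw [lapC, h1, h2, ((hre z).const_mul 2).fderiv, ((him z).const_mul 2).fderiv]
  simp; norm_num

theorem lapC_sqDist_sq (c z : ℂ) :
    lapC (fun z : ℂ => ((z.re - c.re) ^ 2 + (z.im - c.im) ^ 2) ^ 2) z =
      16 * ((z.re - c.re) ^ 2 + (z.im - c.im) ^ 2) := by
  have hre : ∀ w : ℂ, HasFDerivAt (fun z : ℂ => z.re - c.re) Complex.reCLM w := fun w =>
    Complex.reCLM.hasFDerivAt.sub_const _
  have him : ∀ w : ℂ, HasFDerivAt (fun z : ℂ => z.im - c.im) Complex.imCLM w := fun w =>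
    Complex.imCLM.hasFDerivAt.sub_const _
  have hs := fun w => ((hre w).pow 2).fun_add ((him w).pow 2)
  have h := fun w => ((hs w).pow 2).fderiv
  have h1 : (fun w => fderiv ℝ (fun z : ℂ => ((z.re - c.re) ^ 2 + (z.im - c.im) ^ 2) ^ 2) w 1) =
      fun w => 4 * (((w.re - c.re) ^ 2 + (w.im - c.im) ^ 2) * (w.re - c.re)) := by
    funext w; rw [h w]; simp; ring
  have h2 : (fun w => fderiv ℝ (fun z : ℂ => ((z.re - c.re) ^ 2 + (z.im - c.im) ^ 2) ^ 2) w I) =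
      fun w => 4 * (((w.re - c.re) ^ 2 + (w.im - c.im) ^ 2) * (w.im - c.im)) := by
    funext w; rw [h w]; simp; ring
  rw [lapC, h1, h2, (((hs z).fun_mul (hre z)).const_mul 4).fderiv,
    (((hs z).fun_mul (him z)).const_mul 4).fderiv]
  simp; ring

/-- A polynomial vanishing on the circle of radius `R` around `c`, positive inside and strictly
subharmonic near the circle. -/
def hopfBarrier (c : ℂ) (R : ℝ) (z : ℂ) : ℝ :=
  3 * R ^ 2 + (-5 * ((z.re - c.re) ^ 2 + (z.im - c.im) ^ 2) +
    2 / R ^ 2 * ((z.re - c.re) ^ 2 + (z.im - c.im) ^ 2) ^ 2)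

theorem contDiff_hopfBarrier (c : ℂ) (R : ℝ) {n : WithTop ℕ∞} : ContDiff ℝ n (hopfBarrier c R) :=
  contDiff_const.add ((contDiff_const.mul (contDiff_sqDist c)).add
    (contDiff_const.mul ((contDiff_sqDist c).pow 2)))

theorem hopfBarrier_eq (c : ℂ) {R : ℝ} (hR : 0 < R) (z : ℂ) : hopfBarrier c R z =
    (R ^ 2 - dist z c ^ 2) * (1 + 2 * (R ^ 2 - dist z c ^ 2) / R ^ 2) := by
  rw [hopfBarrier, sqDist_eq]
  field_simp
  ring

theorem lapC_hopfBarrier (c : ℂ) (R : ℝ) (z : ℂ) :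
    lapC (hopfBarrier c R) z = -20 + 32 * dist z c ^ 2 / R ^ 2 := by
  have h1 := contDiff_sqDist c (n := 2)
  have e : hopfBarrier c R = fun z => 3 * R ^ 2 +
      (-5 * ((z.re - c.re) ^ 2 + (z.im - c.im) ^ 2) +
        2 / R ^ 2 * ((z.re - c.re) ^ 2 + (z.im - c.im) ^ 2) ^ 2) := rfl
  rw [e, lapC_add contDiff_const ((contDiff_const.mul h1).add (contDiff_const.mul (h1.pow 2))),
    lapC_add (contDiff_const.mul h1) (contDiff_const.mul (h1.pow 2)), lapC_const_mul h1,
    lapC_const_mul (h1.pow 2), lapC_sqDist, lapC_sqDist_sq, sqDist_eq]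
  simp [lapC]
  ring

theorem lapC_hopfBarrier_pos {c z : ℂ} {R : ℝ} (hR : 0 < R) (h : 9 / 10 * R ≤ dist z c) :
    0 < lapC (hopfBarrier c R) z := by
  rw [lapC_hopfBarrier]
  have h2 : (9 / 10 * R) ^ 2 ≤ dist z c ^ 2 := pow_le_pow_left₀ (by positivity) h 2
  have : 20 < 32 * dist z c ^ 2 / R ^ 2 := by
    rw [lt_div_iff₀ (by positivity)]; nlinarith
  linarith

theorem hopfBarrier_le {c z : ℂ} {R : ℝ} (hR : 0 < R) (h : dist z c ≤ R) :
    hopfBarrier c R z ≤ 3 * R ^ 2 := by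
  rw [hopfBarrier_eq c hR]
  have h2 : dist z c ^ 2 ≤ R ^ 2 := pow_le_pow_left₀ dist_nonneg h 2
  have h3 : 0 ≤ dist z c ^ 2 := by positivity
  have h4 : 2 * (R ^ 2 - dist z c ^ 2) / R ^ 2 ≤ 2 := by
    rw [div_le_iff₀ (by positivity)]; nlinarith
  have h5 : 0 ≤ 2 * (R ^ 2 - dist z c ^ 2) / R ^ 2 := by
    apply div_nonneg <;> nlinarith
  nlinarith

theorem le_hopfBarrier {c z : ℂ} {R : ℝ} (hR : 0 < R) (h : dist z c ≤ R) :
    R * (R - dist z c) ≤ hopfBarrier c R z := by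
  rw [hopfBarrier_eq c hR]
  have h2 : dist z c ^ 2 ≤ R ^ 2 := pow_le_pow_left₀ dist_nonneg h 2
  have h5 : 0 ≤ 2 * (R ^ 2 - dist z c ^ 2) / R ^ 2 := by
    apply div_nonneg <;> nlinarith
  have h6 : 0 ≤ dist z c := dist_nonneg
  nlinarith

theorem hopfBarrier_neg {c z : ℂ} {R : ℝ} (hR : 0 < R) (h : R < dist z c)
    (h' : dist z c ≤ 11 / 10 * R) : hopfBarrier c R z < 0 := by
  rw [hopfBarrier_eq c hR]
  have h2 : R ^ 2 < dist z c ^ 2 := pow_lt_pow_left₀ h hR.le (by norm_num)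
  have h3 : dist z c ^ 2 ≤ (11 / 10 * R) ^ 2 := pow_le_pow_left₀ dist_nonneg h' 2
  have h5 : -(1 / 2) ≤ 2 * (R ^ 2 - dist z c ^ 2) / R ^ 2 := by
    rw [le_div_iff₀ (by positivity)]; nlinarith
  nlinarith

theorem hopfBarrier_eq_zero {c z : ℂ} {R : ℝ} (hR : 0 < R) (h : dist z c = R) :
    hopfBarrier c R z = 0 := by
  rw [hopfBarrier_eq c hR, h]; ring

/-! ### The strong maximum principle -/

/-- A closed ball internally tangent to a larger ball meets the bounding circle only at the
point of tangency. -/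
theorem dist_lt_of_mem_closedBall_midpoint {c q z : ℂ} {R : ℝ} (hq : dist q c = 2 * R)
    (hz : dist z (midpoint ℝ c q) ≤ R) (hne : z ≠ q) : dist z c < 2 * R := by
  have hm : dist (midpoint ℝ c q) c = R := by
    rw [dist_midpoint_left, dist_comm, hq]; norm_num; ring
  have htri := dist_triangle z (midpoint ℝ c q) c
  rcases (by linarith : dist z c ≤ 2 * R).lt_or_eq with h | h
  · exact h
  · exfalso
    have hz2 : dist z (midpoint ℝ c q) = R := by linarith
    have : midpoint ℝ c q = midpoint ℝ c z := by
      apply eq_midpoint_of_dist_eq_half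
      · rw [dist_comm, hm, dist_comm, h]; ring
      · rw [dist_comm, hz2, dist_comm c z, h]; ring
    have h3 : q = z := by
      have := (midpoint_eq_iff (R := ℝ)).mp this
      rw [← this]; simp
    exact hne h3.symm

theorem strong_max_principle {v : ℂ → ℝ} (hv : UniformContinuous v) {U : Set ℂ} (hU : IsOpen U)
    (hsub : DSubhOn v U) {z₀ : ℂ} (hz₀ : z₀ ∈ U) (hmax : IsLocalMax v z₀) :
    ∀ᶠ z in nhds z₀, v z = v z₀ := by
  set M := v z₀ with hM
  have hvc := hv.continuous
  obtain ⟨r, hr, hball⟩ := Metric.mem_nhds_iff.mp (Filter.inter_mem (hU.mem_nhds hz₀) hmax)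
  by_contra hcon
  rw [Filter.eventually_iff, Metric.mem_nhds_iff] at hcon
  push Not at hcon
  obtain ⟨c, hc, hcM⟩ := Set.not_subset.mp (hcon (r / 4) (by positivity))
  rw [Metric.mem_ball] at hc
  have hSc : IsClosed {z | v z = M} := isClosed_eq hvc continuous_const
  obtain ⟨q, hq, hqd⟩ := hSc.exists_infDist_eq_dist ⟨z₀, rfl⟩ c
  have hq0 : dist c q ≤ dist c z₀ := hqd ▸ Metric.infDist_le_dist_of_mem (by rfl)
  have hcq : 0 < dist c q := by
    rw [dist_pos]; rintro rfl; exact hcM hq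
  obtain ⟨R, hR, hRq⟩ : ∃ R, 0 < R ∧ dist q c = 2 * R :=
    ⟨dist c q / 2, by positivity, by rw [dist_comm]; ring⟩
  have hqz : dist q z₀ < r / 2 := by
    have := dist_triangle q c z₀
    rw [dist_comm q c] at this; linarith
  have hle : ∀ z, dist z z₀ < r → v z ≤ M := fun z hz => (hball hz).2
  -- the closed ball around `c'` of radius `R` touches `{v = M}` only at `q`
  set c' := midpoint ℝ c q
  have hqc' : dist q c' = R := by
    rw [dist_comm, dist_midpoint_right, dist_comm, hRq]; norm_num; ring
  have hlt : ∀ z, dist z c' ≤ R → z ≠ q → v z < M := by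
    intro z hz hne
    have hzc : dist z c < dist c q := by
      rw [dist_comm c q, hRq]
      exact dist_lt_of_mem_closedBall_midpoint hRq hz hne
    refine lt_of_le_of_ne (hle z ?_) ?_
    · have := dist_triangle z c z₀
      rw [dist_comm c z₀] at hq0
      rw [dist_comm z₀ c] at hq0
      linarith
    · intro h
      have : Metric.infDist c {z | v z = M} ≤ dist c z := Metric.infDist_le_dist_of_mem h
      rw [hqd, dist_comm c z] at this
      linarith
  set s := min (R / 10) (r / 2)
  have hs : 0 < s := by positivity
  have hsR : s ≤ R / 10 := min_le_left _ _
  have hsr : s ≤ r / 2 := min_le_right _ _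
  have hcomp : IsCompact (Metric.sphere q s ∩ Metric.closedBall c' R) :=
    (isCompact_sphere q s).inter_right Metric.isClosed_closedBall
  obtain ⟨δ, hδ, hδv⟩ : ∃ δ > 0, ∀ z ∈ Metric.sphere q s ∩ Metric.closedBall c' R,
      v z ≤ M - δ := by
    rcases (Metric.sphere q s ∩ Metric.closedBall c' R).eq_empty_or_nonempty with he | hne
    · exact ⟨1, one_pos, by simp [he]⟩
    · obtain ⟨x, hx, hxm⟩ := hcomp.exists_isMaxOn hne hvc.continuousOn
      refine ⟨M - v x, ?_, fun z hz => by have : v z ≤ v x := hxm hz; linarith⟩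
      have : x ≠ q := by
        rintro rfl
        have := hx.1; rw [Metric.mem_sphere, dist_self] at this; linarith
      linarith [hlt x hx.2 this]
  set η := δ / (4 * R ^ 2)
  have hη : 0 < η := by positivity
  have hηR : η * (3 * R ^ 2) < δ := by
    have : η * (3 * R ^ 2) = 3 / 4 * δ := by simp only [η]; field_simp
    linarith
  have hbs : ContDiff ℝ 2 (fun z => η * hopfBarrier c' R z) :=
    contDiff_const.mul (contDiff_hopfBarrier c' R)
  have hneg : ∀ z ∈ Metric.sphere q s, v z + η * hopfBarrier c' R z < M := by
    intro z hz
    have hzq : dist z q = s := hz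
    by_cases hzR : dist z c' ≤ R
    · have h1 := hδv z ⟨hz, hzR⟩
      have h2 := mul_le_mul_of_nonneg_left (hopfBarrier_le hR hzR) hη.le
      linarith
    · have h1 := hopfBarrier_neg hR (not_le.mp hzR) (by
        have := dist_triangle z q c'; linarith)
      have h2 := hle z (by have := dist_triangle z q z₀; linarith)
      have := mul_neg_of_pos_of_neg hη h1
      linarith
  obtain ⟨x, hx, hxm⟩ := (isCompact_sphere q s).exists_isMaxOn
    (NormedSpace.sphere_nonempty.mpr hs.le) (hvc.add hbs.continuous).continuousOn
  have hw := weak_max_principle (A := Metric.ball q s) (v := v) Metric.isOpen_ball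
    Metric.isBounded_ball hv (hsub.mono ?_) hbs ?_ (m := v x + η * hopfBarrier c' R x) ?_ q
    (Metric.mem_ball_self hs)
  · rw [hopfBarrier_eq_zero hR hqc'] at hw
    have h1 := hneg x hx
    have h2 : v q = M := hq
    linarith
  · intro z hz
    have hz' : dist z q < s := hz
    exact (hball (by rw [Metric.mem_ball]; have := dist_triangle z q z₀; linarith)).1
  · intro z hz
    have hz' : dist z q < s := hz
    rw [lapC_const_mul (contDiff_hopfBarrier c' R)]
    apply mul_pos hη (lapC_hopfBarrier_pos hR _)
    have := dist_triangle q z c'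
    rw [dist_comm q z] at this; linarith
  · intro z hz
    exact hxm (Metric.frontier_ball_subset_sphere hz)

theorem eq_univ_of_isClosed_maxSet {v : ℂ → ℝ} (hv : UniformContinuous v) {U : Set ℂ}
    (hU : IsOpen U) (hsub : DSubhOn v U) {M : ℝ} (hM : ∀ z ∈ U, v z ≤ M)
    (hcl : IsClosed {z | z ∈ U ∧ v z = M}) (hne : ∃ z ∈ U, v z = M) : ∀ z, z ∈ U ∧ v z = M := by
  have hop : IsOpen {z | z ∈ U ∧ v z = M} := by
    rw [isOpen_iff_mem_nhds]
    rintro z ⟨hz, hzM⟩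
    have hloc : IsLocalMax v z := by
      filter_upwards [hU.mem_nhds hz] with w hw
      rw [hzM]; exact hM w hw
    filter_upwards [hU.mem_nhds hz, strong_max_principle hv hU hsub hz hloc] with w h1 h2
    exact ⟨h1, h2.trans hzM⟩
  have := IsClopen.eq_univ ⟨hcl, hop⟩ (by obtain ⟨z, h⟩ := hne; exact ⟨z, h⟩)
  intro z
  have hz : z ∈ {z | z ∈ U ∧ v z = M} := by rw [this]; trivial
  exact hz

theorem DSubhOn.const_of_periodic {v : ℂ → ℝ} (hc : Continuous v) (hp : PeriodicC v)
    (hsub : DSubhOn v Set.univ) : ∃ c, ∀ z, v z = c := by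
  obtain ⟨z, -, hz⟩ := hp.exists_isMaxOn hc isClosed_univ (fun z => by simp) Set.univ_nonempty
  refine ⟨v z, fun w => (eq_univ_of_isClosed_maxSet (hp.uniformContinuous hc) isOpen_univ hsub hz
    ?_ ⟨z, trivial, rfl⟩ w).2⟩
  simpa using isClosed_eq hc continuous_const

/-- Maximum principle on a proper periodic open set. -/
theorem periodic_max_principle {v : ℂ → ℝ} (hc : Continuous v) (hp : PeriodicC v) {U : Set ℂ}
    (hU : IsOpen U) (hUp : PeriodicC (fun z => z ∈ U)) (hUne : U ≠ Set.univ)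
    (hsub : DSubhOn v U) {m : ℝ} (hm : ∀ z ∈ frontier U, v z ≤ m) : ∀ z ∈ U, v z ≤ m := by
  intro z₀ hz₀
  by_contra! hlt
  have hclp : PeriodicC (fun z => z ∈ closure U) := by
    have key : ∀ a : ℂ, (∀ z, (z + a ∈ U) = (z ∈ U)) → ∀ z, (z + a ∈ closure U) =
        (z ∈ closure U) := by
      intro a ha z
      have h1 : (Homeomorph.addRight a) ⁻¹' U = U := by
        ext w; exact Iff.of_eq (ha w)
      have h2 := (Homeomorph.addRight a).preimage_closure U
      rw [h1] at h2
      exact propext (Set.ext_iff.mp h2 z)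
    exact fun z => ⟨key _ (fun z => (hUp z).1) z, key _ (fun z => (hUp z).2) z⟩
  obtain ⟨z₁, hz₁, hmax⟩ := hp.exists_isMaxOn hc isClosed_closure hclp ⟨z₀, subset_closure hz₀⟩
  have hM : m < v z₁ := hlt.trans_le (hmax z₀ (subset_closure hz₀))
  have hmem : ∀ z ∈ closure U, v z = v z₁ → z ∈ U := by
    intro z hz hvz
    by_contra hn
    have := hm z (hU.frontier_eq ▸ ⟨hz, hn⟩)
    linarith
  have hset : {z | z ∈ U ∧ v z = v z₁} = closure U ∩ {z | v z = v z₁} := by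
    ext z
    exact ⟨fun h => ⟨subset_closure h.1, h.2⟩, fun h => ⟨hmem z h.1 h.2, h.2⟩⟩
  apply hUne
  apply Set.eq_univ_of_forall
  intro z
  refine (eq_univ_of_isClosed_maxSet (hp.uniformContinuous hc) hU hsub
    (fun z hz => hmax z (subset_closure hz)) ?_ ⟨z₁, hmem z₁ hz₁ rfl, rfl⟩ z).1
  rw [hset]
  exact isClosed_closure.inter (isClosed_eq hc continuous_const)

/-! ### Optimal weights: symmetry, contact, uniqueness -/

/-- `ψ` is an optimal weight for the obstacles `φ - τ ≤ φ`. -/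
def IsOptimalWeight (φ : ℂ → ℝ) (τ : ℝ) (ψ : ℂ → ℝ) : Prop :=
  Continuous ψ ∧ PeriodicC ψ ∧ (∀ z, φ z - τ ≤ ψ z ∧ ψ z ≤ φ z) ∧
    DSubhOn ψ {z | φ z - τ < ψ z} ∧ DSuphOn ψ {z | ψ z < φ z}

namespace IsOptimalWeight

variable {φ ψ : ℂ → ℝ} {τ : ℝ}

theorem continuous (h : IsOptimalWeight φ τ ψ) : Continuous ψ := h.1

theorem periodic (h : IsOptimalWeight φ τ ψ) : PeriodicC ψ := h.2.1

theorem lower_le (h : IsOptimalWeight φ τ ψ) (z : ℂ) : φ z - τ ≤ ψ z := (h.2.2.1 z).1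

theorem le_upper (h : IsOptimalWeight φ τ ψ) (z : ℂ) : ψ z ≤ φ z := (h.2.2.1 z).2

theorem subh (h : IsOptimalWeight φ τ ψ) : DSubhOn ψ {z | φ z - τ < ψ z} := h.2.2.2.1

theorem suph (h : IsOptimalWeight φ τ ψ) : DSuphOn ψ {z | ψ z < φ z} := h.2.2.2.2

theorem neg_subh (h : IsOptimalWeight φ τ ψ) : DSubhOn (fun z => -ψ z) {z | ψ z < φ z} :=
  h.suph.neg

theorem neg (h : IsOptimalWeight φ τ ψ) :
    IsOptimalWeight (fun z => τ - φ z) τ (fun z => -ψ z) := by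
  refine ⟨h.continuous.neg, h.periodic.comp _, fun z => ?_, h.neg_subh.mono ?_,
    DSubhOn.neg (h.subh.mono ?_)⟩
  · have h1 := h.lower_le z
    have h2 := h.le_upper z
    constructor <;> linarith
  · intro z hz
    simp only [Set.mem_ofPred_eq] at hz ⊢
    linarith
  · intro z hz
    simp only [Set.mem_ofPred_eq] at hz ⊢
    linarith

theorem exists_upper_contact (h : IsOptimalWeight φ τ ψ)
    (hosc : ∀ c, ¬ ∀ z, φ z - τ ≤ c ∧ c ≤ φ z) : ∃ z, ψ z = φ z := by
  by_contra! hne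
  have hU : {z | ψ z < φ z} = Set.univ :=
    Set.eq_univ_of_forall fun z => lt_of_le_of_ne (h.le_upper z) (hne z)
  have hs := h.neg_subh
  rw [hU] at hs
  obtain ⟨c, hc⟩ := hs.const_of_periodic (v := fun z => -ψ z) h.continuous.neg (h.periodic.comp _)
  refine hosc (-c) fun z => ?_
  rw [← hc z, neg_neg]
  exact ⟨h.lower_le z, h.le_upper z⟩

theorem le_of_isOptimalWeight {ψ' : ℂ → ℝ} (h : IsOptimalWeight φ τ ψ)
    (h' : IsOptimalWeight φ τ ψ') (hosc : ∀ c, ¬ ∀ z, φ z - τ ≤ c ∧ c ≤ φ z) (z : ℂ) :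
    ψ' z ≤ ψ z := by
  by_contra! hlt
  set U := {z | ψ z < ψ' z}
  have hU : IsOpen U := isOpen_lt h.continuous h'.continuous
  have hUne : U ≠ Set.univ := by
    obtain ⟨w, hw⟩ := h.exists_upper_contact hosc
    intro he
    have : w ∈ U := he ▸ trivial
    have h1 : ψ w < ψ' w := this
    linarith [h'.le_upper w]
  have hsub : DSubhOn (fun z => ψ' z + -ψ z) U := by
    refine DSubhOn.add (h'.subh.mono ?_) (h.neg_subh.mono ?_) h'.continuous h.continuous.neg
    · exact fun z (hz : ψ z < ψ' z) => (h.lower_le z).trans_lt hz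
    · exact fun z (hz : ψ z < ψ' z) => hz.trans_le (h'.le_upper z)
  have := periodic_max_principle (v := fun z => ψ' z + -ψ z) (m := 0)
    (h'.continuous.add h.continuous.neg)
    (h'.periodic.comp₂ h.periodic (fun a b => a + -b)) hU
    (h.periodic.comp₂ h'.periodic (fun a b => a < b)) hUne hsub ?_ z hlt
  · linarith
  · intro w hw
    rw [hU.frontier_eq] at hw
    have : ¬ ψ w < ψ' w := hw.2
    linarith

theorem unique {ψ' : ℂ → ℝ} (h : IsOptimalWeight φ τ ψ)
    (h' : IsOptimalWeight φ τ ψ') (hosc : ∀ c, ¬ ∀ z, φ z - τ ≤ c ∧ c ≤ φ z) : ψ' = ψ :=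
  funext fun z => le_antisymm (h.le_of_isOptimalWeight h' hosc z)
    (h'.le_of_isOptimalWeight h hosc z)

end IsOptimalWeight

/-! ### Existence by discretization -/

/-- Second differences are controlled by the oscillation of the second derivative. -/
theorem abs_second_difference_sub_le {f : ℂ → ℝ} (hf : ContDiff ℝ 2 f)
    (B : ℂ →L[ℝ] ℂ →L[ℝ] ℝ) {z v : ℂ} {η : ℝ}
    (hη : ∀ w ∈ Metric.closedBall z ‖v‖, ‖fderiv ℝ (fderiv ℝ f) w - B‖ ≤ η) :
    |f (z + v) + f (z - v) - 2 * f z - B v v| ≤ 2 * η * ‖v‖ ^ 2 := by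
  have hη0 : 0 ≤ η := (ContinuousLinearMap.opNorm_nonneg _).trans
    (hη z (Metric.mem_closedBall_self (norm_nonneg v)))
  have hf1 : ContDiff ℝ 1 (fderiv ℝ f) := hf.fderiv_right le_rfl
  have hd : Differentiable ℝ f := hf.differentiable (by norm_num)
  have hdd : Differentiable ℝ (fderiv ℝ f) := hf1.differentiable (by norm_num)
  have hgrad : ∀ w ∈ Metric.closedBall z ‖v‖,
      ‖fderiv ℝ f w - fderiv ℝ f z - B (w - z)‖ ≤ η * ‖w - z‖ := by
    intro w hw
    have := (convex_closedBall z ‖v‖).norm_image_sub_le_of_norm_hasFDerivWithin_le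
      (f := fun w => fderiv ℝ f w - B w) (f' := fun w => fderiv ℝ (fderiv ℝ f) w - B) (C := η)
      (fun x _ => ((hdd x).hasFDerivAt.fun_sub B.hasFDerivAt).hasFDerivWithinAt) hη
      (Metric.mem_closedBall_self (norm_nonneg v)) hw
    refine le_of_eq_of_le ?_ this
    rw [map_sub]
    congr 1
    abel
  set k : ℝ → ℝ := fun t => f (z + t • v) + f (z - t • v) - t ^ 2 * B v v with hk
  have hkd : ∀ t : ℝ, HasDerivAt k
      (fderiv ℝ f (z + t • v) v + fderiv ℝ f (z - t • v) (-v) - 2 * t * B v v) t := by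
    intro t
    have h1 : HasDerivAt (fun t : ℝ => z + t • v) v t := by
      simpa using ((hasDerivAt_id t).smul_const v).const_add z
    have h2 : HasDerivAt (fun t : ℝ => z - t • v) (-v) t := by
      simpa using ((hasDerivAt_id t).smul_const v).const_sub z
    have h3 : HasDerivAt (fun t : ℝ => t ^ 2 * B v v) (2 * t * B v v) t := by
      simpa using (hasDerivAt_pow 2 t).mul_const (B v v)
    exact (((hd _).hasFDerivAt.comp_hasDerivAt t h1).fun_add
      ((hd _).hasFDerivAt.comp_hasDerivAt t h2)).fun_sub h3
  have hkb : ∀ t ∈ Set.Icc (0 : ℝ) 1,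
      ‖fderiv ℝ f (z + t • v) v + fderiv ℝ f (z - t • v) (-v) - 2 * t * B v v‖
        ≤ 2 * η * ‖v‖ ^ 2 := by
    intro t ht
    have htv : ‖t • v‖ ≤ ‖v‖ := by
      rw [norm_smul, Real.norm_of_nonneg ht.1]
      exact mul_le_of_le_one_left (norm_nonneg v) ht.2
    have h1 := hgrad (z + t • v) (by simpa using htv)
    have h2 := hgrad (z - t • v) (by simpa using htv)
    have e1 : z + t • v - z = t • v := by abel
    have e2 : z - t • v - z = -(t • v) := by abel
    rw [e1] at h1
    rw [e2, norm_neg] at h2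
    have h1' := (ContinuousLinearMap.le_opNorm _ v).trans
      (mul_le_mul_of_nonneg_right h1 (norm_nonneg v))
    have h2' := (ContinuousLinearMap.le_opNorm _ v).trans
      (mul_le_mul_of_nonneg_right h2 (norm_nonneg v))
    have hsum := norm_sub_le_of_le h1' h2'
    have hle : η * ‖t • v‖ * ‖v‖ ≤ η * ‖v‖ ^ 2 := by
      rw [sq, mul_assoc]
      gcongr
    refine le_trans (le_of_eq_of_le ?_ hsum) (by linarith)
    congr 1
    simp only [map_neg, map_smul, sub_apply, neg_apply, smul_apply, smul_eq_mul]
    ring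
  have := (convex_Icc (0 : ℝ) 1).norm_image_sub_le_of_norm_hasDerivWithin_le
    (fun t _ => (hkd t).hasDerivWithinAt) hkb (Set.left_mem_Icc.2 zero_le_one)
    (Set.right_mem_Icc.2 zero_le_one)
  simp only [hk, one_smul, zero_smul, add_zero, sub_zero, Real.norm_eq_abs, abs_one,
    mul_one, one_pow] at this
  refine le_of_eq_of_le ?_ this
  congr 1
  ring

/-- The average of `u` over the four points `z ± h`, `z ± ih`. -/
def crossAvg (h : ℝ) (u : ℂ → ℝ) (z : ℂ) : ℝ :=
  (u (z + h) + u (z - h) + u (z + h * I) + u (z - h * I)) / 4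

theorem lapC_sub_crossAvg_le {χ : ℂ → ℝ} (hχ : ContDiff ℝ 2 χ) {z : ℂ} {h η : ℝ} (h0 : 0 < h)
    (hη : ∀ w ∈ Metric.closedBall z h,
      ‖fderiv ℝ (fderiv ℝ χ) w - fderiv ℝ (fderiv ℝ χ) z‖ ≤ η) :
    |4 / h ^ 2 * (crossAvg h χ z - χ z) - lapC χ z| ≤ 4 * η := by
  have hn : ‖(h : ℂ)‖ = h := by simp [abs_of_pos h0]
  have hn' : ‖(h : ℂ) * I‖ = h := by simp [abs_of_pos h0]
  have h1 := abs_second_difference_sub_le hχ (fderiv ℝ (fderiv ℝ χ) z) (v := h) (η := η)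
    (by rwa [hn])
  have h2 := abs_second_difference_sub_le hχ (fderiv ℝ (fderiv ℝ χ) z) (v := h * I) (η := η)
    (by rwa [hn'])
  rw [hn] at h1
  rw [hn'] at h2
  have e1 : (h : ℂ) = h • (1 : ℂ) := by simp
  have e2 : (h : ℂ) * I = h • I := by simp
  have b1 : fderiv ℝ (fderiv ℝ χ) z (h : ℂ) (h : ℂ) =
      h ^ 2 * fderiv ℝ (fderiv ℝ χ) z 1 1 := by
    rw [e1]; simp only [map_smul, smul_apply, smul_eq_mul]; ring
  have b2 : fderiv ℝ (fderiv ℝ χ) z (h * I) (h * I) =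
      h ^ 2 * fderiv ℝ (fderiv ℝ χ) z I I := by
    rw [e2]; simp only [map_smul, smul_apply, smul_eq_mul]; ring
  rw [b1] at h1
  rw [b2] at h2
  have key : h ^ 2 * (4 / h ^ 2 * (crossAvg h χ z - χ z) - lapC χ z) =
      (χ (z + h) + χ (z - h) - 2 * χ z - h ^ 2 * fderiv ℝ (fderiv ℝ χ) z 1 1) +
      (χ (z + h * I) + χ (z - h * I) - 2 * χ z - h ^ 2 * fderiv ℝ (fderiv ℝ χ) z I I) := by
    rw [lapC_eq_fderiv_fderiv hχ.contDiffAt, crossAvg]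
    field_simp
    ring
  have h3 := (abs_add_le _ _).trans (add_le_add h1 h2)
  rw [← key, abs_mul, abs_of_pos (by positivity : 0 < h ^ 2)] at h3
  refine le_of_mul_le_mul_left ?_ (by positivity : 0 < h ^ 2)
  linarith

theorem continuous_crossAvg {u : ℂ → ℝ} (hu : Continuous u) (h : ℝ) :
    Continuous (crossAvg h u) := by
  unfold crossAvg
  fun_prop

theorem integral_crossAvg_mul {u χ : ℂ → ℝ} (hu : Continuous u) (hχ : Continuous χ)
    (hχc : HasCompactSupport χ) (h : ℝ) :
    ∫ z, crossAvg h u z * χ z = ∫ z, u z * crossAvg h χ z := by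
  have hshift : ∀ a : ℂ, ∫ z, u (z + a) * χ z = ∫ z, u z * χ (z - a) := by
    intro a
    rw [← integral_add_right_eq_self (fun z => u z * χ (z - a)) a]
    simp
  have hi1 : ∀ a : ℂ, Integrable (fun z => u (z + a) * χ z) := fun a =>
    Continuous.integrable_of_hasCompactSupport (by fun_prop) hχc.mul_left
  have hi2 : ∀ a : ℂ, Integrable (fun z => u z * χ (z + a)) := fun a =>
    Continuous.integrable_of_hasCompactSupport (by fun_prop)
      (hχc.comp_homeomorph (Homeomorph.addRight a)).mul_left
  have e1 : ∀ z, crossAvg h u z * χ z = (u (z + h) * χ z + u (z + -h) * χ z +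
      u (z + h * I) * χ z + u (z + -(h * I)) * χ z) / 4 := by
    intro z; simp only [crossAvg, ← sub_eq_add_neg]; ring
  have e2 : ∀ z, u z * crossAvg h χ z = (u z * χ (z + h) + u z * χ (z + -h) +
      u z * χ (z + h * I) + u z * χ (z + -(h * I))) / 4 := by
    intro z; simp only [crossAvg, ← sub_eq_add_neg]; ring
  simp_rw [e1, e2, integral_div]
  rw [integral_add, integral_add, integral_add, integral_add, integral_add, integral_add]
  · simp only [hshift, sub_neg_eq_add]
    simp only [← sub_eq_add_neg]
    ring
  all_goals first
    | exact hi1 _ | exact hi2 _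
    | exact (hi1 _).fun_add (hi1 _) | exact (hi2 _).fun_add (hi2 _)
    | exact ((hi1 _).fun_add (hi1 _)).fun_add (hi1 _)
    | exact ((hi2 _).fun_add (hi2 _)).fun_add (hi2 _)

theorem ContinuousAt.exists_norm_sub_le {E F : Type*} [PseudoMetricSpace E]
    [NormedAddCommGroup F] {f : E → F} {z : E} (hf : ContinuousAt f z) {ε : ℝ} (hε : 0 < ε) :
    ∃ δ > 0, ∀ w, dist w z < δ → ‖f w - f z‖ ≤ ε := by
  obtain ⟨δ, hδ, h⟩ := Metric.continuousAt_iff.1 hf ε hε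
  exact ⟨δ, hδ, fun w hw => by rw [← dist_eq_norm]; exact (h hw).le⟩

theorem HasCompactSupport.exists_norm_le {E F : Type*} [TopologicalSpace E]
    [NormedAddCommGroup F] {f : E → F} (hf : Continuous f) (hc : HasCompactSupport f) :
    ∃ C, 0 ≤ C ∧ ∀ z, ‖f z‖ ≤ C := by
  obtain ⟨C, hC⟩ := hc.exists_bound_of_continuous hf
  exact ⟨max C 0, le_max_right _ _, fun z => (hC z).trans (le_max_left _ _)⟩

theorem exists_norm_fderiv_fderiv_le {χ : ℂ → ℝ} (hχ : ContDiff ℝ 2 χ)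
    (hχc : HasCompactSupport χ) : ∃ C, 0 ≤ C ∧ ∀ z, ‖fderiv ℝ (fderiv ℝ χ) z‖ ≤ C := 
  HasCompactSupport.exists_norm_le
    ((hχ.fderiv_right (m := 1) le_rfl).continuous_fderiv (by norm_num))
    (HasCompactSupport.fderiv (𝕜 := ℝ) (HasCompactSupport.fderiv (𝕜 := ℝ) hχc))

/-- Limits of discretely subharmonic functions are distributionally subharmonic. -/
theorem DSubhOn.of_tendsto_crossAvg {u : ℕ → ℂ → ℝ} {ψ : ℂ → ℝ} {h : ℕ → ℝ} {U : Set ℂ} {M : ℝ}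
    (hu : ∀ n, Continuous (u n)) (hM : ∀ n z, |u n z| ≤ M)
    (hlim : ∀ z, Filter.Tendsto (fun n => u n z) Filter.atTop (nhds (ψ z)))
    (h0 : ∀ n, 0 < h n) (h1 : ∀ n, h n ≤ 1) (hh : Filter.Tendsto h Filter.atTop (nhds 0))
    (hsub : ∀ K ⊆ U, IsCompact K → ∀ᶠ n in Filter.atTop, ∀ z ∈ K, u n z ≤ crossAvg (h n) (u n) z) :
    DSubhOn ψ U := by
  intro χ hχ hχc hχ0 hχU
  have hχ2 : ContDiff ℝ 2 χ :=
    hχ.of_le (WithTop.coe_le_coe.2 le_top : ((2 : ℕ∞) : WithTop ℕ∞) ≤ (⊤ : ℕ∞))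
  have hχd : Continuous (fderiv ℝ (fderiv ℝ χ)) :=
    (hχ2.fderiv_right (m := 1) le_rfl).continuous_fderiv (by norm_num)
  have hM0 : 0 ≤ M := (abs_nonneg _).trans (hM 0 0)
  obtain ⟨C, hC0, hC⟩ := exists_norm_fderiv_fderiv_le hχ2 hχc
  set q : ℕ → ℂ → ℝ := fun n z => 4 / h n ^ 2 * (crossAvg (h n) χ z - χ z) with hq
  set K₁ := Metric.cthickening 1 (tsupport χ)
  have hK₁ : IsCompact K₁ := hχc.isCompact.cthickening
  have hqb : ∀ n z, |q n z| ≤ 8 * C + |lapC χ z| := by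
    intro n z
    have h3 := lapC_sub_crossAvg_le hχ2 (z := z) (h0 n) (η := 2 * C) (fun w _ => by
      refine (norm_sub_le (fderiv ℝ (fderiv ℝ χ) w) (fderiv ℝ (fderiv ℝ χ) z)).trans ?_
      linarith [hC w, hC z])
    have h4 := abs_add_le (q n z - lapC χ z) (lapC χ z)
    rw [sub_add_cancel] at h4
    have h5 : |q n z - lapC χ z| ≤ 4 * (2 * C) := h3
    linarith
  have hq0 : ∀ n z, z ∉ K₁ → q n z = 0 := by
    intro n z hz
    have hne : ∀ w, dist z w ≤ 1 → χ w = 0 := by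
      intro w hw
      by_contra hw'
      exact hz (Metric.mem_cthickening_of_dist_le z w 1 _ (subset_tsupport χ hw') hw)
    have hd : ∀ a : ℂ, ‖a‖ ≤ 1 → χ (z + a) = 0 ∧ χ (z - a) = 0 := fun a ha =>
      ⟨hne _ (by simpa [dist_eq_norm] using ha), hne _ (by simpa [dist_eq_norm] using ha)⟩
    have ha := hd (h n) (by simpa [abs_of_pos (h0 n)] using h1 n)
    have hb := hd (h n * I) (by simpa [abs_of_pos (h0 n)] using h1 n)
    simp [hq, crossAvg, ha.1, ha.2, hb.1, hb.2, hne z (by simp)]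
  have hqlim : ∀ z, Filter.Tendsto (fun n => q n z) Filter.atTop (nhds (lapC χ z)) := by
    intro z
    rw [Metric.tendsto_atTop']
    intro ε hε
    obtain ⟨δ, hδ, hδ'⟩ := ContinuousAt.exists_norm_sub_le
      (f := fderiv ℝ (fderiv ℝ χ)) (hχd.continuousAt (x := z)) (by positivity : 0 < ε / 8)
    obtain ⟨N, hN⟩ := Filter.eventually_atTop.1 (hh.eventually (gt_mem_nhds hδ))
    refine ⟨N, fun n hn => ?_⟩
    have := lapC_sub_crossAvg_le hχ2 (z := z) (h0 n) (η := ε / 8) (fun w hw => by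
      exact hδ' w (lt_of_le_of_lt hw (hN n hn.le)))
    rw [Real.dist_eq]
    exact lt_of_le_of_lt this (by linarith)
  have hqc : ∀ n, Continuous (q n) := fun n =>
    continuous_const.mul ((continuous_crossAvg hχ.continuous _).sub hχ.continuous)
  have hlapc : Continuous (lapC χ) := continuous_lapC hχ2
  have hT : Filter.Tendsto (fun n => ∫ z, u n z * q n z) Filter.atTop
      (nhds (∫ z, ψ z * lapC χ z)) := by
    refine tendsto_integral_of_dominated_convergence
      (K₁.indicator (fun z => M * (8 * C + |lapC χ z|)))
      (fun n => ((hu n).mul (hqc n)).aestronglyMeasurable) ?_ ?_ ?_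
    · rw [integrable_indicator_iff hK₁.measurableSet]
      exact ContinuousOn.integrableOn_compact hK₁ (by fun_prop)
    · refine fun n => Filter.Eventually.of_forall fun z => ?_
      by_cases hz : z ∈ K₁
      · rw [Set.indicator_of_mem hz, Real.norm_eq_abs, abs_mul]
        exact mul_le_mul (hM n z) (hqb n z) (abs_nonneg _) hM0
      · simp [Set.indicator_of_notMem hz, hq0 n z hz]
    · exact Filter.Eventually.of_forall fun z => (hlim z).mul (hqlim z)
  refine ge_of_tendsto hT ?_
  filter_upwards [hsub _ hχU hχc.isCompact] with n hn
  have hi1 : Integrable (fun z => u n z * crossAvg (h n) χ z - u n z * χ z) := by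
    refine Continuous.integrable_of_hasCompactSupport
      (((hu n).mul (continuous_crossAvg hχ.continuous _)).sub ((hu n).mul hχ.continuous)) ?_
    refine HasCompactSupport.intro hK₁ fun z hz => ?_
    have := hq0 n z hz
    have hp : 4 / h n ^ 2 ≠ 0 := by have := h0 n; positivity
    have h' := (mul_eq_zero.1 this).resolve_left hp
    rw [← mul_sub, h', mul_zero]
  have hi2 : Integrable (fun z => u n z * χ z) :=
    ((hu n).mul hχ.continuous).integrable_of_hasCompactSupport hχc.mul_left
  have hi3 : Integrable (fun z => crossAvg (h n) (u n) z * χ z) :=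
    ((continuous_crossAvg (hu n) _).mul hχ.continuous).integrable_of_hasCompactSupport
      hχc.mul_left
  have hi4 : Integrable (fun z => u n z * crossAvg (h n) χ z) := by
    simpa using hi1.fun_add hi2
  have e : ∫ z, u n z * q n z =
      4 / h n ^ 2 * ∫ z, (crossAvg (h n) (u n) z - u n z) * χ z := by
    simp_rw [sub_mul]
    rw [integral_sub hi3 hi2, integral_crossAvg_mul (hu n) hχ.continuous hχc,
      ← integral_sub hi4 hi2, ← integral_const_mul]
    congr 1
    ext z
    simp only [hq]
    ring
  rw [e]
  refine mul_nonneg (by positivity) (integral_nonneg fun z => ?_)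
  by_cases hz : z ∈ tsupport χ
  · exact mul_nonneg (sub_nonneg.2 (hn z hz)) (hχ0 z)
  · simp [image_eq_zero_of_notMem_tsupport hz]

/-- The projected averaging operator of the discretized double obstacle problem. -/
def obstacleStep (φ : ℂ → ℝ) (τ h : ℝ) (u : ℂ → ℝ) (z : ℂ) : ℝ :=
  min (φ z) (max (φ z - τ) (crossAvg h u z))

theorem crossAvg_mono {u v : ℂ → ℝ} (huv : ∀ z, u z ≤ v z) (h : ℝ) (z : ℂ) :
    crossAvg h u z ≤ crossAvg h v z := by
  unfold crossAvg
  linarith [huv (z + h), huv (z - h), huv (z + h * I), huv (z - h * I)]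

theorem LipschitzWith.crossAvg {L : NNReal} {u : ℂ → ℝ} (hu : LipschitzWith L u) (h : ℝ) :
    LipschitzWith L (crossAvg h u) := by
  refine LipschitzWith.of_le_add_mul L fun z w => ?_
  have hs : ∀ a : ℂ, u (z + a) ≤ u (w + a) + L * dist z w := fun a => by
    simpa using hu.le_add_mul (z + a) (w + a)
  have h1 := hs h
  have h2 := hs (-h)
  have h3 := hs (h * I)
  have h4 := hs (-(h * I))
  simp only [_root_.crossAvg, sub_eq_add_neg]
  linarith

theorem PeriodicC.crossAvg {u : ℂ → ℝ} (hu : PeriodicC u) (h : ℝ) :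
    PeriodicC (crossAvg h u) := by
  intro z
  have e : ∀ p a : ℂ, z + p + a = z + a + p := fun p a => by ring
  simp only [_root_.crossAvg, sub_eq_add_neg, e, (hu _).1, (hu _).2, and_self]

theorem LipschitzWith.obstacleStep {L : NNReal} {φ u : ℂ → ℝ} (hφ : LipschitzWith L φ)
    (hu : LipschitzWith L u) (τ h : ℝ) : LipschitzWith L (obstacleStep φ τ h u) := by
  have h1 : LipschitzWith L (fun z => φ z - τ) := by
    simpa using hφ.sub (LipschitzWith.const τ)
  have h2 := hφ.min (h1.max (hu.crossAvg h))
  rwa [max_self, max_self] at h2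

theorem exists_discrete_solution {L : NNReal} {φ : ℂ → ℝ} (hφ : LipschitzWith L φ)
    (hφp : PeriodicC φ) {τ : ℝ} (hτ : 0 ≤ τ) (h : ℝ) :
    ∃ u : ℂ → ℝ, LipschitzWith L u ∧ PeriodicC u ∧ ∀ z, u z = obstacleStep φ τ h u z := by
  set T := obstacleStep φ τ h with hT
  set U : ℕ → ℂ → ℝ := fun n => T^[n] (fun z => φ z - τ) with hU
  have hsucc : ∀ n, U (n + 1) = T (U n) := fun n => Function.iterate_succ_apply' _ _ _
  have hle : ∀ n z, U n z ≤ φ z := by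
    intro n z
    cases n with
    | zero => simpa [hU] using hτ
    | succ n => rw [hsucc]; exact min_le_left _ _
  have hmono : ∀ z, Monotone (fun n => U n z) := by
    intro z
    refine monotone_nat_of_le_succ fun n => ?_
    induction n generalizing z with
    | zero =>
      rw [hsucc]
      exact le_min (hle 0 z) (le_max_left _ _)
    | succ n ih =>
      rw [hsucc (n + 1)]
      nth_rewrite 1 [hsucc n]
      exact min_le_min le_rfl (max_le_max le_rfl (crossAvg_mono ih h z))
  have hlip : ∀ n, LipschitzWith L (U n) := by
    intro n
    induction n with
    | zero => simpa [hU] using hφ.sub (LipschitzWith.const τ)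
    | succ n ih => rw [hsucc]; exact hφ.obstacleStep ih τ h
  have hper : ∀ n, PeriodicC (U n) := by
    intro n
    induction n with
    | zero => exact hφp.comp (fun a => a - τ)
    | succ n ih =>
      rw [hsucc]
      exact hφp.comp₂ (ih.crossAvg h) (fun a b => min a (max (a - τ) b))
  set u : ℂ → ℝ := fun z => ⨆ n, U n z
  have hlim : ∀ z, Filter.Tendsto (fun n => U n z) Filter.atTop (nhds (u z)) := fun z =>
    tendsto_atTop_ciSup (hmono z) ⟨φ z, by rintro _ ⟨n, rfl⟩; exact hle n z⟩
  refine ⟨u, LipschitzWith.of_le_add_mul L fun z w => ?_, fun z => ?_, fun z => ?_⟩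
  · exact le_of_tendsto_of_tendsto' (hlim z) ((hlim w).add_const _)
      fun n => (hlip n).le_add_mul z w
  · simp only [u, (hper _ _).1, (hper _ _).2, and_self]
  · refine tendsto_nhds_unique ((hlim z).comp (Filter.tendsto_add_atTop_nat 1)) ?_
    have : Filter.Tendsto (fun n => T (U n) z) Filter.atTop (nhds (T u z)) := by
      simp only [hT, obstacleStep, crossAvg]
      exact tendsto_const_nhds.min (tendsto_const_nhds.max
        (((((hlim _).add (hlim _)).add (hlim _)).add (hlim _)).div_const 4))
    simpa [Function.comp_def, hsucc] using this

/-- Compactness of uniformly bounded, uniformly Lipschitz periodic functions. -/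
theorem exists_tendsto_uniformly_of_lipschitz {L : NNReal} {u : ℕ → ℂ → ℝ} {M : ℝ}
    (hL : ∀ n, LipschitzWith L (u n)) (hp : ∀ n, PeriodicC (u n)) (hM : ∀ n z, |u n z| ≤ M) :
    ∃ ψ : ℂ → ℝ, LipschitzWith L ψ ∧ PeriodicC ψ ∧
      ∀ k : ℕ, ∃ n ≥ k, ∀ z, |u n z - ψ z| ≤ 1 / ((k : ℝ) + 1) := by
  have hex : ∀ z, ∃ a,
      Filter.Tendsto (fun n => u n z) (Filter.hyperfilter ℕ : Filter ℕ) (nhds a) := by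
    intro z
    obtain ⟨a, -, ha⟩ := (isCompact_Icc (a := -M) (b := M)).ultrafilter_le_nhds
      ((Filter.hyperfilter ℕ).map (fun n => u n z)) (by
        rw [Filter.le_principal_iff]
        exact Filter.mem_map.2 (Filter.Eventually.of_forall fun n => abs_le.1 (hM n z)))
    exact ⟨a, ha⟩
  choose ψ hψ using hex
  have hψL : LipschitzWith L ψ := LipschitzWith.of_le_add_mul L fun z w =>
    le_of_tendsto_of_tendsto' (hψ z) ((hψ w).add_const _) fun n => (hL n).le_add_mul z w
  have hψp : PeriodicC ψ := by
    intro z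
    constructor
    · refine tendsto_nhds_unique (hψ _) ?_
      simpa only [(hp _ _).1] using hψ z
    · refine tendsto_nhds_unique (hψ _) ?_
      simpa only [(hp _ _).2] using hψ z
  refine ⟨ψ, hψL, hψp, fun k => ?_⟩
  set η : ℝ := 1 / ((k : ℝ) + 1) with hη
  have hη0 : 0 < η := by positivity
  have hr : 0 < η / (4 * (L + 1)) := by positivity
  obtain ⟨t, htf, ht⟩ := Metric.totallyBounded_iff.1
    isCompact_closedSquare.totallyBounded _ hr
  have hev : ∀ᶠ n in (Filter.hyperfilter ℕ : Filter ℕ), ∀ y ∈ t, |u n y - ψ y| < η / 2 := by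
    rw [Filter.eventually_all_finite htf]
    intro y _
    have := (Metric.tendsto_nhds.1 (hψ y)) (η / 2) (by positivity)
    simpa only [Real.dist_eq] using this
  have hk : ∀ᶠ n in (Filter.hyperfilter ℕ : Filter ℕ), k ≤ n :=
    Nat.hyperfilter_le_atTop (Filter.eventually_ge_atTop k)
  obtain ⟨n, hn, hnk⟩ := (hev.and hk).exists
  refine ⟨n, hnk, fun z => ?_⟩
  rw [← (hp n).add_latticeShift z z, ← hψp.add_latticeShift z z]
  have hz := Efd_subset_closedSquare (add_latticeShift_mem z)
  generalize z + latticeShift z = z' at hz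
  obtain ⟨y, hy, hyz⟩ := Set.mem_iUnion₂.1 (ht hz)
  have hyz' : dist z' y < η / (4 * (L + 1)) := hyz
  have hLd : L * dist z' y ≤ η / 4 := by
    rw [lt_div_iff₀ (by positivity)] at hyz'
    nlinarith [dist_nonneg (x := z') (y := y)]
  have h1 := (hL n).dist_le_mul z' y
  have h2 := hψL.dist_le_mul z' y
  rw [Real.dist_eq] at h1 h2
  have h3 := abs_lt.1 (hn y hy)
  have h4 := abs_le.1 h1
  have h5 := abs_le.1 h2
  rw [abs_le]
  constructor <;> linarith

theorem crossAvg_neg (h : ℝ) (u : ℂ → ℝ) (z : ℂ) :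
    crossAvg h (fun w => -u w) z = -crossAvg h u z := by
  unfold crossAvg
  ring

theorem exists_isOptimalWeight {L : NNReal} {φ : ℂ → ℝ} (hφ : LipschitzWith L φ)
    (hφp : PeriodicC φ) {τ : ℝ} (hτ : 0 < τ) : ∃ ψ, IsOptimalWeight φ τ ψ ∧ LipschitzWith L ψ := by
  choose u hL hp hu using fun n : ℕ =>
    exists_discrete_solution hφ hφp hτ.le (1 / ((n : ℝ) + 1))
  have hlow : ∀ n z, φ z - τ ≤ u n z := fun n z => by
    rw [hu n z]
    exact le_min (by linarith) (le_max_left _ _)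
  have hup : ∀ n z, u n z ≤ φ z := fun n z => by
    rw [hu n z]
    exact min_le_left _ _
  have hsub : ∀ n z, φ z - τ < u n z → u n z ≤ crossAvg (1 / ((n : ℝ) + 1)) (u n) z := by
    intro n z hz
    by_contra! hlt
    have := (hu n z).le.trans (min_le_right _ _)
    exact absurd this (not_le.2 (max_lt hz hlt))
  have hsup : ∀ n z, u n z < φ z → crossAvg (1 / ((n : ℝ) + 1)) (u n) z ≤ u n z := by
    intro n z hz
    by_contra! hlt
    have : u n z < obstacleStep φ τ (1 / ((n : ℝ) + 1)) (u n) z :=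
      lt_min hz (hlt.trans_le (le_max_right _ _))
    exact absurd (hu n z) this.ne
  obtain ⟨C, hC0, hC⟩ := hφp.exists_bound hφ.continuous
  have hM : ∀ n z, |u n z| ≤ C + τ := by
    intro n z
    have h1 := abs_le.1 (hC z)
    rw [abs_le]
    constructor <;> linarith [hlow n z, hup n z]
  obtain ⟨ψ, hψL, hψp, hconv⟩ := exists_tendsto_uniformly_of_lipschitz hL hp hM
  choose N hN hNψ using hconv
  have h0 : Filter.Tendsto (fun k : ℕ => 1 / ((k : ℝ) + 1)) Filter.atTop (nhds 0) :=
    tendsto_one_div_add_atTop_nhds_zero_nat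
  have hNt : Filter.Tendsto N Filter.atTop Filter.atTop :=
    Filter.tendsto_atTop_mono hN Filter.tendsto_id
  have hlim : ∀ z, Filter.Tendsto (fun k => u (N k) z) Filter.atTop (nhds (ψ z)) := by
    intro z
    rw [tendsto_iff_dist_tendsto_zero]
    exact squeeze_zero (fun _ => dist_nonneg) (fun k => by
      rw [Real.dist_eq]; exact hNψ k z) h0
  have hpos : ∀ k, 0 < 1 / ((N k : ℝ) + 1) := fun k => by positivity
  have hle1 : ∀ k, 1 / ((N k : ℝ) + 1) ≤ 1 := fun k => by
    rw [div_le_one (by positivity)]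
    linarith [(N k).cast_nonneg (α := ℝ)]
  refine ⟨ψ, ⟨hψL.continuous, hψp, fun z => ⟨?_, ?_⟩, ?_, ?_⟩, hψL⟩
  · exact ge_of_tendsto' (hlim z) fun k => hlow _ z
  · exact le_of_tendsto' (hlim z) fun k => hup _ z
  · refine DSubhOn.of_tendsto_crossAvg (fun k => (hL (N k)).continuous) (fun k => hM (N k)) hlim
      hpos hle1 (h0.comp hNt) fun K hK hKc => ?_
    obtain ⟨m, hm, hmK⟩ := hKc.exists_forall_le' (f := fun z => ψ z - (φ z - τ))
      (hψL.continuous.sub (hφ.continuous.sub continuous_const)).continuousOn (a := 0)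
      fun z hz => sub_pos.2 (hK hz)
    filter_upwards [h0.eventually (gt_mem_nhds hm)] with k hk z hz
    refine hsub _ z ?_
    have h1 := hmK z hz
    have h2 := abs_le.1 (hNψ k z)
    linarith
  · have : DSubhOn (fun z => -ψ z) {z | ψ z < φ z} := by
      refine DSubhOn.of_tendsto_crossAvg (u := fun k z => -u (N k) z)
        (fun k => (hL (N k)).continuous.neg)
        (fun k z => by rw [abs_neg]; exact hM (N k) z) (fun z => (hlim z).neg)
        hpos hle1 (h0.comp hNt) fun K hK hKc => ?_
      obtain ⟨m, hm, hmK⟩ := hKc.exists_forall_le' (f := fun z => φ z - ψ z)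
        (hφ.continuous.sub hψL.continuous).continuousOn (a := 0)
        fun z hz => sub_pos.2 (hK hz)
      filter_upwards [h0.eventually (gt_mem_nhds hm)] with k hk z hz
      rw [crossAvg_neg, neg_le_neg_iff]
      refine hsup _ z ?_
      have h1 := hmK z hz
      have h2 := abs_le.1 (hNψ k z)
      linarith
    simpa only [neg_neg] using this.neg

/-! ### Second derivative estimates -/

theorem LipschitzWith.norm_fderiv_apply_le {L : NNReal} {f : ℂ → ℝ} (hL : LipschitzWith L f)
    (w : ℂ) {e : ℂ} (he : ‖e‖ = 1) : ‖((fderiv ℝ f w e : ℝ) : ℂ)‖ ≤ L := by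
  rw [Complex.norm_real]
  have h1 := (fderiv ℝ f w).le_opNorm e
  rw [he, mul_one] at h1
  exact h1.trans (norm_fderiv_le_of_lipschitz ℝ hL)

/-- Interior estimate for the second derivative of a Lipschitz harmonic function. -/
theorem norm_fderiv_fderiv_le_of_harmonic {L : NNReal} {f : ℂ → ℝ} (hf : ContDiff ℝ 2 f)
    (hL : LipschitzWith L f) {z : ℂ} {r : ℝ} (hr : 0 < r)
    (hlap : ∀ w ∈ Metric.ball z r, lapC f w = 0) :
    ‖fderiv ℝ (fderiv ℝ f) z‖ ≤ 8 * L / r := by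
  set g : ℂ → ℂ := fun w => fderiv ℝ f w 1 - I * fderiv ℝ f w I with hg
  have hdd : Differentiable ℝ (fderiv ℝ f) :=
    (hf.fderiv_right (m := 1) le_rfl).differentiable (by norm_num)
  have hgd : ∀ w ∈ Metric.ball z r, DifferentiableAt ℂ g w := by
    intro w hw
    refine HarmonicAt.differentiableAt_complex_partial ⟨hf.contDiffAt, ?_⟩
    filter_upwards [Metric.isOpen_ball.mem_nhds hw] with y hy
    have := hlap y hy
    rw [lapC_eq_fderiv_fderiv hf.contDiffAt] at this
    rw [InnerProductSpace.laplacian_eq_iteratedFDeriv_complexPlane]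
    simpa [iteratedFDeriv_two_apply] using this
  have hgb : ∀ w, ‖g w‖ ≤ 2 * L := by
    intro w
    have h1 := hL.norm_fderiv_apply_le w norm_one
    have h2 := hL.norm_fderiv_apply_le w norm_I
    refine (norm_sub_le _ _).trans ?_
    rw [norm_mul, norm_I, one_mul]
    linarith
  have hder : ‖deriv g z‖ ≤ 2 * L / (r / 2) := by
    refine Complex.norm_deriv_le_of_forall_mem_sphere_norm_le (by positivity) ?_ fun w _ => hgb w
    refine DifferentiableOn.diffContOnCl fun w hw => (hgd w ?_).differentiableWithinAt
    rw [closure_ball z (by positivity : r / 2 ≠ 0)] at hw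
    exact Metric.closedBall_subset_ball (by linarith) hw
  have hgz := (hgd z (Metric.mem_ball_self hr)).hasDerivAt.hasFDerivAt.restrictScalars ℝ
  have hgz' : HasFDerivAt g
      (ofRealCLM.comp ((ContinuousLinearMap.apply ℝ ℝ (1 : ℂ)).comp (fderiv ℝ (fderiv ℝ f) z)) -
        I • ofRealCLM.comp ((ContinuousLinearMap.apply ℝ ℝ I).comp (fderiv ℝ (fderiv ℝ f) z)))
      z := by
    have h1 := (ContinuousLinearMap.apply ℝ ℝ (1 : ℂ)).hasFDerivAt.comp z (hdd z).hasFDerivAt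
    have h2 := (ContinuousLinearMap.apply ℝ ℝ I).hasFDerivAt.comp z (hdd z).hasFDerivAt
    exact (ofRealCLM.hasFDerivAt.comp z h1).fun_sub
      ((ofRealCLM.hasFDerivAt.comp z h2).const_smul I)
  have hcmp : ∀ e : ℂ, e * deriv g z =
      (fderiv ℝ (fderiv ℝ f) z e 1 : ℂ) - I * (fderiv ℝ (fderiv ℝ f) z e I : ℂ) := by
    intro e
    have := DFunLike.congr_fun (hgz.unique hgz') e
    simpa using this
  refine ContinuousLinearMap.opNorm_le_bound₂ _ (by positivity) fun e y => ?_
  have hn : ‖e * deriv g z‖ ≤ 4 * L / r * ‖e‖ := by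
    rw [norm_mul, mul_comm]
    refine mul_le_mul_of_nonneg_right (hder.trans (le_of_eq ?_)) (norm_nonneg _)
    field_simp
    ring
  have h1 : |fderiv ℝ (fderiv ℝ f) z e 1| ≤ ‖e * deriv g z‖ := by
    have := Complex.abs_re_le_norm (e * deriv g z)
    rw [hcmp e] at this ⊢
    simpa using this
  have h2 : |fderiv ℝ (fderiv ℝ f) z e I| ≤ ‖e * deriv g z‖ := by
    have := Complex.abs_im_le_norm (e * deriv g z)
    rw [hcmp e] at this ⊢
    simpa using this
  have hy : fderiv ℝ (fderiv ℝ f) z e y =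
      y.re * fderiv ℝ (fderiv ℝ f) z e 1 + y.im * fderiv ℝ (fderiv ℝ f) z e I := by
    have : y = y.re • (1 : ℂ) + y.im • I := by
      simp [Complex.re_add_im]
    conv_lhs => rw [this]
    simp only [map_add, map_smul, smul_eq_mul]
  rw [hy, Real.norm_eq_abs]
  refine (abs_add_le _ _).trans ?_
  rw [abs_mul, abs_mul]
  have a1 := mul_le_mul (Complex.abs_re_le_norm y) (h1.trans hn) (abs_nonneg _) (norm_nonneg _)
  have a2 := mul_le_mul (Complex.abs_im_le_norm y) (h2.trans hn) (abs_nonneg _) (norm_nonneg _)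
  calc _ ≤ _ := add_le_add a1 a2
    _ = _ := by ring

/-- Interior second difference estimate for Lipschitz distributionally harmonic functions. -/
theorem abs_second_difference_le_of_harmonic {L : NNReal} {u : ℂ → ℝ} (hL : LipschitzWith L u)
    {A : Set ℂ} (hsub : DSubhOn u A) (hsup : DSubhOn (fun z => -u z) A) {z v : ℂ} {r : ℝ}
    (hr : 0 < r) (hball : Metric.ball z r ⊆ A) (hv : ‖v‖ ≤ r / 4) :
    |u (z + v) + u (z - v) - 2 * u z| ≤ 64 * L / r * ‖v‖ ^ 2 := by
  refine le_of_forall_pos_le_add fun η hη => ?_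
  obtain ⟨δ, hδ, hclose⟩ := exists_mol_close hL.uniformContinuous (by positivity : 0 < η / 4)
  obtain ⟨ρ, hρ⟩ := exists_bump (lt_min (half_pos hδ) (half_pos (half_pos hr)))
  have hρδ : ρ.rOut < δ := by
    rw [hρ]; exact (min_le_left _ _).trans_lt (half_lt_self hδ)
  have hρr : ρ.rOut ≤ r / 2 / 2 := by
    rw [hρ]; exact min_le_right _ _
  have hlap : ∀ w ∈ Metric.ball z (3 * r / 4), lapC (mol ρ u) w = 0 := by
    intro w hw
    have hsubA : Metric.closedBall w ρ.rOut ⊆ A := by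
      refine fun y hy => hball ?_
      rw [Metric.mem_ball] at hw ⊢
      have := dist_triangle y w z
      have : dist y w ≤ ρ.rOut := hy
      linarith
    have h1 := lapC_mol_nonneg ρ hL.continuous hsub hsubA
    have h2 := lapC_mol_nonneg ρ hL.continuous.neg hsup hsubA
    have e : mol ρ (fun w => -u w) = fun w => -mol ρ u w := funext fun w => mol_neg ρ w
    change 0 ≤ lapC (mol ρ (fun w => -u w)) w at h2
    rw [e, lapC_neg] at h2
    linarith
  have h2 := abs_second_difference_sub_le (contDiff_two_mol ρ hL.continuous) 0 (z := z) (v := v)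
    (η := 16 * L / r) (fun w hw => by
      rw [sub_zero]
      refine (norm_fderiv_fderiv_le_of_harmonic (contDiff_two_mol ρ hL.continuous)
        (lipschitzWith_mol ρ hL) (half_pos hr) fun y hy => hlap y ?_).trans (le_of_eq ?_)
      · rw [Metric.mem_ball] at hy ⊢
        have := dist_triangle y w z
        have : dist w z ≤ ‖v‖ := hw
        linarith
      · field_simp
        ring)
  simp only [zero_apply, sub_zero] at h2
  have h3 := abs_le.1 (hclose ρ hρδ (z + v))
  have h4 := abs_le.1 (hclose ρ hρδ (z - v))
  have h5 := abs_le.1 (hclose ρ hρδ z)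
  have h6 := abs_le.1 h2
  have h7 : 2 * (16 * L / r) * ‖v‖ ^ 2 ≤ 64 * L / r * ‖v‖ ^ 2 := by
    refine mul_le_mul_of_nonneg_right ?_ (by positivity)
    rw [← mul_div_assoc]
    refine div_le_div_of_nonneg_right ?_ hr.le
    linarith [L.coe_nonneg]
  rw [abs_le]
  constructor <;> linarith

theorem fderiv_fderiv_le_of_second_difference {f : ℂ → ℝ} (hf : ContDiff ℝ 2 f) {z : ℂ}
    {C δ : ℝ} (hδ : 0 < δ)
    (h : ∀ v : ℂ, ‖v‖ ≤ δ → f (z + v) + f (z - v) - 2 * f z ≤ C * ‖v‖ ^ 2) (e : ℂ) :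
    fderiv ℝ (fderiv ℝ f) z e e ≤ C * ‖e‖ ^ 2 := by
  refine le_of_forall_pos_le_add fun η hη => ?_
  have hcont : Continuous (fderiv ℝ (fderiv ℝ f)) :=
    (hf.fderiv_right (m := 1) le_rfl).continuous_fderiv (by norm_num)
  have hη' : 0 < η / (2 * (‖e‖ ^ 2 + 1)) := by positivity
  obtain ⟨δ', hδ', hosc⟩ := ContinuousAt.exists_norm_sub_le
    (f := fderiv ℝ (fderiv ℝ f)) (hcont.continuousAt (x := z)) hη'
  set t : ℝ := min δ δ' / (‖e‖ + 1) / 2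
  have hm : 0 < min δ δ' := lt_min hδ hδ'
  have ht : 0 < t := by positivity
  have hte : ‖t • e‖ < min δ δ' := by
    rw [norm_smul, Real.norm_of_nonneg ht.le]
    have : t * (‖e‖ + 1) = min δ δ' / 2 := by
      simp only [t]
      field_simp
    nlinarith [norm_nonneg e]
  have h1 := h (t • e) (hte.le.trans (min_le_left _ _))
  have h2 := abs_second_difference_sub_le hf (fderiv ℝ (fderiv ℝ f) z) (z := z) (v := t • e)
    (fun w hw => hosc w (lt_of_le_of_lt hw (hte.trans_le (min_le_right _ _))))
  have h3 := (abs_le.1 h2).1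
  simp only [map_smul, smul_apply, smul_eq_mul, norm_smul, Real.norm_of_nonneg ht.le] at h1 h3
  have h4 : 2 * (η / (2 * (‖e‖ ^ 2 + 1))) * ‖e‖ ^ 2 ≤ η := by
    have : 2 * (η / (2 * (‖e‖ ^ 2 + 1))) * ‖e‖ ^ 2 = η * (‖e‖ ^ 2 / (‖e‖ ^ 2 + 1)) := by
      field_simp
    rw [this]
    refine mul_le_of_le_one_right hη.le ?_
    rw [div_le_one (by positivity)]
    linarith
  have ht2 : 0 < t ^ 2 := by positivity
  refine le_of_mul_le_mul_left ?_ ht2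
  nlinarith

/-- A symmetric bilinear form bounded above, with nonnegative trace, is bounded. -/
theorem norm_le_of_forall_le_of_trace_nonneg (B : ℂ →L[ℝ] ℂ →L[ℝ] ℝ) (hsymm : B 1 I = B I 1)
    {C : ℝ} (hC : 0 ≤ C) (hle : ∀ e, B e e ≤ C * ‖e‖ ^ 2) (htr : 0 ≤ B 1 1 + B I I) :
    ‖B‖ ≤ 4 * C := by
  have h1 := hle 1
  have h2 := hle I
  have h3 := hle (1 + I)
  have h4 := hle (1 - I)
  have n3 : ‖1 + I‖ ^ 2 = 2 := by
    rw [Complex.sq_norm, Complex.normSq_apply]; simp; norm_num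
  have n4 : ‖1 - I‖ ^ 2 = 2 := by
    rw [Complex.sq_norm, Complex.normSq_apply]; simp; norm_num
  rw [n3] at h3
  rw [n4] at h4
  simp only [map_add, map_sub, add_apply, sub_apply] at h3 h4
  simp only [norm_one, norm_I, one_pow, mul_one] at h1 h2
  have a1 : |B 1 1| ≤ C := abs_le.2 ⟨by linarith, h1⟩
  have a2 : |B I I| ≤ C := abs_le.2 ⟨by linarith, h2⟩
  have a3 : |B I 1| ≤ C := abs_le.2 ⟨by linarith, by linarith⟩
  refine ContinuousLinearMap.opNorm_le_bound₂ _ (by positivity) fun x y => ?_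
  have e : ∀ y : ℂ, y = y.re • (1 : ℂ) + y.im • I := fun y => by simp [Complex.re_add_im]
  have hxy : B x y = x.re * (y.re * B 1 1 + y.im * B I 1) +
      x.im * (y.re * B I 1 + y.im * B I I) := by
    conv_lhs => rw [e x, e y]
    simp only [map_add, map_smul, add_apply, smul_apply, smul_eq_mul, hsymm]
    ring
  have key : ∀ a b c : ℝ, |c| ≤ C → |a| ≤ ‖x‖ → |b| ≤ ‖y‖ → |a * (b * c)| ≤ C * ‖x‖ * ‖y‖ := by
    intro a b c hc ha hb
    rw [abs_mul, abs_mul]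
    calc |a| * (|b| * |c|) ≤ ‖x‖ * (‖y‖ * C) := by gcongr
      _ = _ := by ring
  have k1 := abs_le.1 (key _ _ _ a1 (Complex.abs_re_le_norm x) (Complex.abs_re_le_norm y))
  have k2 := abs_le.1 (key _ _ _ a3 (Complex.abs_re_le_norm x) (Complex.abs_im_le_norm y))
  have k3 := abs_le.1 (key _ _ _ a3 (Complex.abs_im_le_norm x) (Complex.abs_re_le_norm y))
  have k4 := abs_le.1 (key _ _ _ a2 (Complex.abs_im_le_norm x) (Complex.abs_im_le_norm y))
  rw [hxy, Real.norm_eq_abs, abs_le]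
  constructor <;> nlinarith

/-! ### `C^{1,1}` regularity -/

namespace IsOptimalWeight

variable {φ ψ : ℂ → ℝ} {τ : ℝ} {L L' : NNReal}

theorem osc_neg (hosc : ∀ c, ¬ ∀ z, φ z - τ ≤ c ∧ c ≤ φ z) (c : ℝ) :
    ¬ ∀ z, τ - φ z - τ ≤ c ∧ c ≤ τ - φ z := fun h =>
  hosc (-c) fun z => ⟨by linarith [(h z).2], by linarith [(h z).1]⟩

theorem exists_gap_modulus (hL : LipschitzWith L ψ) (hφL : LipschitzWith L' φ) (hτ : 0 < τ) :
    ∃ r > 0, ∀ z w, dist w z ≤ r → |(ψ w - φ w) - (ψ z - φ z)| ≤ τ / 8 := by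
  refine ⟨τ / (8 * (L + L' + 1)), by positivity, fun z w hzw => ?_⟩
  have h1 := abs_le.1 ((Real.dist_eq _ _).symm.le.trans (hL.dist_le_mul w z))
  have h2 := abs_le.1 ((Real.dist_eq _ _).symm.le.trans (hφL.dist_le_mul w z))
  have h3 : (L + L') * dist w z ≤ τ / 8 := by
    rw [le_div_iff₀ (by positivity)] at hzw
    nlinarith [dist_nonneg (x := w) (y := z)]
  rw [abs_le]
  constructor <;> linarith

theorem second_difference_le (h : IsOptimalWeight φ τ ψ) (hL : LipschitzWith L ψ)
    (hφ : ContDiff ℝ 2 φ) {C : ℝ} (hC : ∀ z, ‖fderiv ℝ (fderiv ℝ φ) z‖ ≤ C) (hC0 : 0 ≤ C)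
    (hφp : PeriodicC φ) (hτ : 0 < τ) (hosc : ∀ c, ¬ ∀ z, φ z - τ ≤ c ∧ c ≤ φ z) {r : ℝ}
    (hr : 0 < r) (hgap : ∀ z w, dist w z ≤ r → |(ψ w - φ w) - (ψ z - φ z)| ≤ τ / 8) {z v : ℂ}
    (hz : φ z - 3 * τ / 4 < ψ z) (hv : ‖v‖ ≤ r / 4) :
    ψ (z + v) + ψ (z - v) - 2 * ψ z ≤ (2 * C + 64 * L / r) * ‖v‖ ^ 2 := by
  have hcont := h.continuous
  have hφc := hφ.continuous
  have hm1 : 0 ≤ 64 * L / r * ‖v‖ ^ 2 := by positivity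
  have hm2 : 0 ≤ 2 * C * ‖v‖ ^ 2 := by positivity
  have hup : ∀ w, ψ w = φ w →
      ψ (w + v) + ψ (w - v) - 2 * ψ w ≤ (2 * C + 64 * L / r) * ‖v‖ ^ 2 := by
    intro w hw
    have h1 := abs_second_difference_sub_le hφ 0 (z := w) (v := v) (η := C)
      (fun y _ => by rw [sub_zero]; exact hC y)
    simp only [zero_apply, sub_zero] at h1
    have h2 := (abs_le.1 h1).2
    rw [add_mul]
    linarith [h.le_upper (w + v), h.le_upper (w - v)]
  by_cases hzc : ψ z = φ z
  · exact hup z hzc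
  set D : Set ℂ := {w | φ w - 3 * τ / 4 < ψ w ∧ ψ w < φ w} with hD
  have hDo : IsOpen D :=
    (isOpen_lt (by fun_prop) hcont).inter (isOpen_lt hcont hφc)
  have hDp : PeriodicC (fun w => w ∈ D) :=
    hφp.comp₂ h.periodic (fun a b => a - 3 * τ / 4 < b ∧ b < a)
  have hDne : D ≠ Set.univ := by
    obtain ⟨w, hw⟩ := h.exists_upper_contact hosc
    intro he
    have : w ∈ D := he ▸ trivial
    exact absurd hw this.2.ne
  have hvr : ‖v‖ ≤ r := hv.trans (by linarith)
  have hsub : DSubhOn (fun w => (ψ (w + v) + ψ (w + -v)) + 2 * -ψ w) D := by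
    refine DSubhOn.add (DSubhOn.add (h.subh.translate v ?_) (h.subh.translate (-v) ?_)
      (by fun_prop) (by fun_prop)) (h.neg_subh.mono ?_ |>.const_mul (by norm_num))
      (by fun_prop) (by fun_prop)
    · intro w hw
      have h1 := abs_le.1 (hgap w (w + v) (by simpa using hvr))
      have h2 := hw.1
      change φ (w + v) - τ < ψ (w + v)
      linarith
    · intro w hw
      have h1 := abs_le.1 (hgap w (w + -v) (by simpa using hvr))
      have h2 := hw.1
      change φ (w + -v) - τ < ψ (w + -v)
      linarith
    · exact fun w hw => hw.2
  have hper : PeriodicC (fun w => (ψ (w + v) + ψ (w + -v)) + 2 * -ψ w) :=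
    ((h.periodic.translate v).comp₂ (h.periodic.translate (-v)) (fun a b => a + b)).comp₂
      h.periodic (fun a b => a + 2 * -b)
  have := periodic_max_principle (v := fun w => (ψ (w + v) + ψ (w + -v)) + 2 * -ψ w)
    (m := (2 * C + 64 * L / r) * ‖v‖ ^ 2) (by fun_prop) hper hDo hDp hDne hsub ?_ z
    ⟨hz, lt_of_le_of_ne (h.le_upper z) hzc⟩
  · rw [sub_eq_add_neg z v]
    linarith
  · intro w hw
    rw [hDo.frontier_eq] at hw
    have hcl : φ w - 3 * τ / 4 ≤ ψ w := by
      have : closure D ⊆ {w | φ w - 3 * τ / 4 ≤ ψ w} :=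
        closure_minimal (fun y hy => hy.1.le) (isClosed_le (by fun_prop) hcont)
      exact this hw.1
    rw [← sub_eq_add_neg w v]
    by_cases hwc : ψ w = φ w
    · linarith [hup w hwc]
    · have hwlt : ψ w < φ w := lt_of_le_of_ne (h.le_upper w) hwc
      have hweq : ψ w = φ w - 3 * τ / 4 := by
        refine le_antisymm ?_ hcl
        by_contra! hlt
        exact hw.2 ⟨hlt, hwlt⟩
      have hball : Metric.ball w r ⊆ {y | φ y - τ < ψ y} ∩ {y | ψ y < φ y} := by
        intro y hy
        have h1 := abs_le.1 (hgap w y (Metric.mem_ball.1 hy).le)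
        constructor
        · change φ y - τ < ψ y
          linarith
        · change ψ y < φ y
          linarith
      have h2 := abs_second_difference_le_of_harmonic hL
        (h.subh.mono Set.inter_subset_left) (h.neg_subh.mono Set.inter_subset_right) hr hball hv
      have h3 := (abs_le.1 h2).2
      rw [add_mul]
      linarith

theorem norm_fderiv_fderiv_mol_le (h : IsOptimalWeight φ τ ψ) (hL : LipschitzWith L ψ)
    (hφ : ContDiff ℝ 2 φ) {C : ℝ} (hC : ∀ z, ‖fderiv ℝ (fderiv ℝ φ) z‖ ≤ C) (hC0 : 0 ≤ C)
    (hφp : PeriodicC φ) (hτ : 0 < τ) (hosc : ∀ c, ¬ ∀ z, φ z - τ ≤ c ∧ c ≤ φ z) {r : ℝ}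
    (hr : 0 < r) (hgap : ∀ z w, dist w z ≤ r → |(ψ w - φ w) - (ψ z - φ z)| ≤ τ / 8)
    (ρ : ContDiffBump (0 : ℂ)) (hρ : ρ.rOut ≤ r) {z : ℂ} (hz : φ z - τ / 2 ≤ ψ z) :
    ‖fderiv ℝ (fderiv ℝ (mol ρ ψ)) z‖ ≤ 4 * (2 * C + 64 * L / r) := by
  have hcont := h.continuous
  have hm2 := contDiff_two_mol ρ hcont
  have hnear : ∀ w, dist w z ≤ ρ.rOut → φ w - 3 * τ / 4 < ψ w := by
    intro w hw
    have h1 := abs_le.1 (hgap z w (hw.trans hρ))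
    linarith
  refine norm_le_of_forall_le_of_trace_nonneg _ ?_ (by positivity)
    (fderiv_fderiv_le_of_second_difference hm2 (by positivity : 0 < r / 4) fun v hv => ?_) ?_
  · exact (hm2.contDiffAt.isSymmSndFDerivAt (by simp)).eq 1 I
  · have e : mol ρ (fun w => (ψ (w + v) + ψ (w + -v)) + 2 * -ψ w) z =
        mol ρ ψ (z + v) + mol ρ ψ (z - v) - 2 * mol ρ ψ z := by
      rw [mol_add ρ (by fun_prop) (by fun_prop), mol_add ρ (by fun_prop) (by fun_prop),
        mol_translate, mol_translate, mol_const_mul, mol_neg, ← sub_eq_add_neg z v]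
      ring
    rw [← e]
    refine mol_le ρ (by fun_prop) fun t ht => ?_
    have h1 := h.second_difference_le hL hφ hC hC0 hφp hτ hosc hr hgap (z := z - t) (v := v)
      (hnear _ (by simpa [dist_eq_norm] using ht)) hv
    rw [← sub_eq_add_neg (z - t) v]
    linarith
  · rw [← lapC_eq_fderiv_fderiv hm2.contDiffAt]
    refine lapC_mol_nonneg ρ hcont h.subh fun w hw => ?_
    have h1 := hnear w hw
    change φ w - τ < ψ w
    linarith

theorem exists_norm_fderiv_fderiv_mol_le (h : IsOptimalWeight φ τ ψ) (hL : LipschitzWith L ψ)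
    (hφL : LipschitzWith L' φ) (hφ : ContDiff ℝ 2 φ) (hφp : PeriodicC φ) (hτ : 0 < τ)
    (hosc : ∀ c, ¬ ∀ z, φ z - τ ≤ c ∧ c ≤ φ z) :
    ∃ K : NNReal, ∃ r > 0, ∀ ρ : ContDiffBump (0 : ℂ), ρ.rOut ≤ r →
      ∀ z, ‖fderiv ℝ (fderiv ℝ (mol ρ ψ)) z‖ ≤ K := by
  obtain ⟨r, hr, hgap⟩ := exists_gap_modulus hL hφL hτ
  obtain ⟨C, hC0, hC⟩ := PeriodicC.exists_bound (v := fderiv ℝ (fderiv ℝ φ))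
    ((hφ.fderiv_right (m := 1) le_rfl).continuous_fderiv (by norm_num)) hφp.fderiv.fderiv
  refine ⟨⟨4 * (2 * C + 64 * L / r), by positivity⟩, r, hr, fun ρ hρ z => ?_⟩
  rcases le_total (φ z - τ / 2) (ψ z) with hz | hz
  · exact h.norm_fderiv_fderiv_mol_le hL hφ hC hC0 hφp hτ hosc hr hgap ρ hρ hz
  · have hneg : ∀ f : ℂ → ℝ, fderiv ℝ (fderiv ℝ fun w => -f w) =
        fun w => -fderiv ℝ (fderiv ℝ f) w := by
      intro f
      have : fderiv ℝ (fun w => -f w) = fun w => -fderiv ℝ f w := funext fun w => fderiv_fun_neg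
      rw [this]
      exact funext fun w => fderiv_fun_neg
    have hφ' : ContDiff ℝ 2 (fun z => τ - φ z) := contDiff_const.sub hφ
    have hC' : ∀ z, ‖fderiv ℝ (fderiv ℝ fun z => τ - φ z) z‖ ≤ C := by
      intro z
      have : fderiv ℝ (fun z => τ - φ z) = fderiv ℝ (fun z => -φ z) :=
        funext fun w => by rw [fderiv_const_sub, fderiv_fun_neg]
      rw [this, hneg]
      exact (ContinuousLinearMap.opNorm_neg _).le.trans (hC z)
    have := h.neg.norm_fderiv_fderiv_mol_le (L := L) hL.neg hφ' hC' hC0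
      (hφp.comp _) hτ (osc_neg hosc) hr (fun z w hw => by
        have := hgap z w hw
        rw [abs_le] at this ⊢
        constructor <;> linarith) ρ hρ (z := z) (by linarith)
    have e : mol ρ (fun w => -ψ w) = fun w => -mol ρ ψ w := funext fun w => mol_neg ρ w
    rw [e, hneg] at this
    exact (ContinuousLinearMap.opNorm_neg _).symm.le.trans this

end IsOptimalWeight

theorem abs_sub_sub_fderiv_le {f : ℂ → ℝ} (hf : Differentiable ℝ f) {K : NNReal}
    (hK : LipschitzWith K (fderiv ℝ f)) (z w : ℂ) :
    |f w - f z - fderiv ℝ f z (w - z)| ≤ K * dist w z ^ 2 := by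
  have := (convex_closedBall z (dist w z)).norm_image_sub_le_of_norm_hasFDerivWithin_le'
    (f := f) (f' := fderiv ℝ f) (φ := fderiv ℝ f z) (C := K * dist w z)
    (fun x _ => (hf x).hasFDerivAt.hasFDerivWithinAt) (fun x hx => by
      rw [← dist_eq_norm]
      exact (hK.dist_le_mul x z).trans (by gcongr; exact hx))
    (Metric.mem_closedBall_self dist_nonneg) (Metric.mem_closedBall.2 le_rfl)
  rw [Real.norm_eq_abs, ← dist_eq_norm] at this
  exact this.trans (le_of_eq (by ring))

theorem hasFDerivAt_of_abs_sub_sub_le {f : ℂ → ℝ} {z : ℂ} {G : ℂ →L[ℝ] ℝ} {K : ℝ}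
    (h : ∀ w, |f w - f z - G (w - z)| ≤ K * dist w z ^ 2) : HasFDerivAt f G z := by
  have h1 : HasFDerivAt (fun w => f w - f z - (G w - G z)) (0 : ℂ →L[ℝ] ℝ) z := by
    refine Asymptotics.IsBigO.hasFDerivAt (n := 2) (Asymptotics.IsBigO.of_bound K ?_) (by norm_num)
    refine Filter.Eventually.of_forall fun w => ?_
    have := h w
    rw [dist_eq_norm] at this
    rw [norm_pow, norm_norm]
    refine le_of_eq_of_le ?_ this
    rw [Real.norm_eq_abs, map_sub]
  have h2 := h1.fun_add ((G.hasFDerivAt (x := z)).add_const (f z - G z))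
  rw [zero_add] at h2
  refine h2.congr_of_eventuallyEq (Filter.Eventually.of_forall fun w => ?_)
  ring

/-- Uniform second derivative bounds on mollifications yield `C^{1,1}` regularity. -/
theorem lipschitzWith_fderiv_of_mol {L K : NNReal} {u : ℂ → ℝ} (hL : LipschitzWith L u) {r : ℝ}
    (hr : 0 < r) (hK : ∀ ρ : ContDiffBump (0 : ℂ), ρ.rOut ≤ r →
      ∀ z, ‖fderiv ℝ (fderiv ℝ (mol ρ u)) z‖ ≤ K) :
    Differentiable ℝ u ∧ LipschitzWith K (fderiv ℝ u) := by
  choose ρ hρ using fun n : ℕ => exists_bump (by positivity : 0 < r / ((n : ℝ) + 1))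
  have hρr : ∀ n, (ρ n).rOut ≤ r := fun n => by
    rw [hρ]
    exact div_le_self hr.le (by linarith [n.cast_nonneg (α := ℝ)])
  have hlimρ : Filter.Tendsto (fun n => (ρ n).rOut) Filter.atTop (nhds 0) := by
    simp only [hρ]
    simpa [div_eq_mul_inv] using
      (tendsto_one_div_add_atTop_nhds_zero_nat (𝕜 := ℝ)).const_mul r
  have hlim : ∀ z, Filter.Tendsto (fun n => mol (ρ n) u z)
      (Filter.hyperfilter ℕ : Filter ℕ) (nhds (u z)) := by
    intro z
    refine Filter.Tendsto.mono_left ?_ Nat.hyperfilter_le_atTop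
    rw [Metric.tendsto_atTop']
    intro ε hε
    obtain ⟨δ, hδ, hclose⟩ := exists_mol_close hL.uniformContinuous (half_pos hε)
    obtain ⟨N, hN⟩ := Filter.eventually_atTop.1 (hlimρ.eventually (gt_mem_nhds hδ))
    refine ⟨N, fun n hn => ?_⟩
    rw [Real.dist_eq]
    exact (hclose _ (hN n hn.le) z).trans_lt (half_lt_self hε)
  have hm2 : ∀ n, ContDiff ℝ 2 (mol (ρ n) u) := fun n => contDiff_two_mol _ hL.continuous
  have hKn : ∀ n, LipschitzWith K (fderiv ℝ (mol (ρ n) u)) := fun n =>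
    lipschitzWith_of_nnnorm_fderiv_le
      (((hm2 n).fderiv_right (m := 1) le_rfl).differentiable (by norm_num)) fun z =>
        hK (ρ n) (hρr n) z
  have hex : ∀ z, ∃ G : ℂ →L[ℝ] ℝ, Filter.Tendsto (fun n => fderiv ℝ (mol (ρ n) u) z)
      (Filter.hyperfilter ℕ : Filter ℕ) (nhds G) := by
    intro z
    obtain ⟨G, -, hG⟩ := (isCompact_closedBall (0 : ℂ →L[ℝ] ℝ) L).ultrafilter_le_nhds
      ((Filter.hyperfilter ℕ).map (fun n => fderiv ℝ (mol (ρ n) u) z)) (by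
        rw [Filter.le_principal_iff]
        refine Filter.mem_map.2 (Filter.Eventually.of_forall fun n => ?_)
        refine mem_closedBall_zero_iff.2 ?_
        exact norm_fderiv_le_of_lipschitz ℝ (lipschitzWith_mol _ hL))
    exact ⟨G, hG⟩
  choose G hG using hex
  have hder : ∀ z, HasFDerivAt u (G z) z := by
    intro z
    refine hasFDerivAt_of_abs_sub_sub_le (K := K) fun w => ?_
    have hGw : Filter.Tendsto (fun n => fderiv ℝ (mol (ρ n) u) z (w - z))
        (Filter.hyperfilter ℕ : Filter ℕ) (nhds (G z (w - z))) :=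
      ((ContinuousLinearMap.apply ℝ ℝ (w - z)).continuous.tendsto (G z)).comp (hG z)
    refine le_of_tendsto' (((hlim w).sub (hlim z)).sub hGw).abs fun n => ?_
    exact abs_sub_sub_fderiv_le ((hm2 n).differentiable (by norm_num)) (hKn n) z w
  have hfd : fderiv ℝ u = G := funext fun z => (hder z).fderiv
  refine ⟨fun z => (hder z).differentiableAt, ?_⟩
  rw [hfd]
  refine LipschitzWith.of_dist_le_mul fun z w => ?_
  exact le_of_tendsto' ((hG z).dist (hG w)) fun n => (hKn n).dist_le_mul z w

/-! ### Location of the contact sets -/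

theorem PeriodicC.exists_lipschitzWith {f : ℂ → ℝ} (hp : PeriodicC f) (hf : ContDiff ℝ 1 f) :
    ∃ K : NNReal, LipschitzWith K f := by
  obtain ⟨C, hC0, hC⟩ := PeriodicC.exists_bound (v := _root_.fderiv ℝ f)
    (hf.continuous_fderiv (by norm_num)) hp.fderiv
  exact ⟨⟨C, hC0⟩, lipschitzWith_of_nnnorm_fderiv_le (hf.differentiable (by norm_num))
    fun z => hC z⟩

theorem PeriodicC.exists_lipschitzWith_fderiv {f : ℂ → ℝ} (hp : PeriodicC f)
    (hf : ContDiff ℝ 2 f) : ∃ K : NNReal, LipschitzWith K (_root_.fderiv ℝ f) := by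
  have hf1 : ContDiff ℝ 1 (_root_.fderiv ℝ f) := hf.fderiv_right le_rfl
  obtain ⟨C, hC0, hC⟩ := PeriodicC.exists_bound (v := _root_.fderiv ℝ (_root_.fderiv ℝ f))
    (hf1.continuous_fderiv (by norm_num)) hp.fderiv.fderiv
  exact ⟨⟨C, hC0⟩, lipschitzWith_of_nnnorm_fderiv_le (hf1.differentiable (by norm_num))
    fun z => hC z⟩

theorem le_mul_sq_dist_of_nonneg {g : ℂ → ℝ} (hg : Differentiable ℝ g) {K : NNReal}
    (hK : LipschitzWith K (fderiv ℝ g)) (hg0 : ∀ z, 0 ≤ g z) {z : ℂ} (hz : g z = 0) (w : ℂ) :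
    g w ≤ K * dist w z ^ 2 := by
  have hmin : IsLocalMin g z := Filter.Eventually.of_forall fun y => by rw [hz]; exact hg0 y
  have := (abs_le.1 (abs_sub_sub_fderiv_le hg hK z w)).2
  rw [hmin.fderiv_eq_zero, hz] at this
  simpa using this

/-- Interior ball for the negativity set of a function at a zero with nonzero gradient. -/
theorem exists_ball_subset_neg {f : ℂ → ℝ} (hf : Differentiable ℝ f) {K : NNReal}
    (hK : LipschitzWith K (fderiv ℝ f)) {p : ℂ} (hp : f p = 0) (hg : fderiv ℝ f p ≠ 0) {s : ℝ}
    (hs : 0 < s) : ∃ c : ℂ, ∃ R > 0, R ≤ s ∧ dist p c = R ∧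
      ∀ z, dist z c ≤ R → z ≠ p → f z < 0 := by
  set a : ℂ := ⟨fderiv ℝ f p 1, fderiv ℝ f p I⟩ with ha
  have hrep : ∀ h : ℂ, fderiv ℝ f p h = a.re * h.re + a.im * h.im := by
    intro h
    have : h = h.re • (1 : ℂ) + h.im • I := by simp [Complex.re_add_im]
    conv_lhs => rw [this]
    simp only [map_add, map_smul, smul_eq_mul, ha]
    ring
  have ha0 : a ≠ 0 := by
    intro h0
    refine hg (ContinuousLinearMap.ext fun h => ?_)
    rw [hrep, h0]
    simp
  have hna : 0 < ‖a‖ := norm_pos_iff.2 ha0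
  set R : ℝ := min s (‖a‖ / (4 * (K + 1))) with hRdef
  have hR : 0 < R := by positivity
  have hRa : R * (4 * (K + 1)) ≤ ‖a‖ := by
    rw [← le_div_iff₀ (by positivity)]
    exact min_le_right _ _
  set t : ℝ := R / ‖a‖ with htdef
  have ht : t * ‖a‖ = R := by rw [htdef]; field_simp
  have ht0 : 0 < t := by positivity
  refine ⟨p - t • a, R, hR, min_le_left _ _, ?_, fun z hz hne => ?_⟩
  · rw [dist_eq_norm]
    simp only [sub_sub_cancel, norm_smul, Real.norm_of_nonneg ht0.le, ht]
  have hpos : 0 < dist z p := dist_pos.2 hne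
  have h1 := (abs_le.1 (abs_sub_sub_fderiv_le hf hK p z)).2
  rw [hp, hrep] at h1
  have h2 : dist z (p - t • a) ^ 2 ≤ R ^ 2 := by gcongr
  rw [← sqDist_eq] at h2
  have h3 := sqDist_eq z p
  have h4 : ‖a‖ ^ 2 = a.re ^ 2 + a.im ^ 2 := by
    rw [Complex.sq_norm, Complex.normSq_apply]; ring
  simp only [Complex.sub_re, Complex.sub_im, Complex.real_smul, Complex.mul_re, Complex.mul_im,
    Complex.ofReal_re, Complex.ofReal_im, zero_mul, sub_zero, add_zero] at h1 h2
  have h5 : dist z p ^ 2 + 2 * t * (a.re * (z.re - p.re) + a.im * (z.im - p.im)) ≤ 0 := by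
    have : R ^ 2 = t ^ 2 * (a.re ^ 2 + a.im ^ 2) := by rw [← h4, ← ht]; ring
    rw [← h3]
    nlinarith
  have h6 : t * (4 * (K + 1)) ≤ 1 := by
    refine le_of_mul_le_mul_right ?_ hna
    nlinarith
  have h7 : 0 < dist z p ^ 2 := by positivity
  have hK0 := K.coe_nonneg
  have h8 : t * f z < 0 := by
    have : t * f z ≤ t * (a.re * (z.re - p.re) + a.im * (z.im - p.im)) +
        t * K * dist z p ^ 2 := by
      nlinarith
    nlinarith [mul_pos ht0 h7]
  exact (mul_neg_iff.1 h8).resolve_right (fun h => absurd h.1 (not_lt.2 ht0.le)) |>.2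

namespace IsOptimalWeight

variable {φ ψ : ℂ → ℝ} {τ : ℝ}

theorem uniformContinuous (h : IsOptimalWeight φ τ ψ) : UniformContinuous ψ :=
  h.periodic.uniformContinuous h.continuous

theorem lapC_nonneg_of_contact (h : IsOptimalWeight φ τ ψ) (hφ : ContDiff ℝ 2 φ) (hτ : 0 < τ)
    {z : ℂ} (hz : ψ z = φ z) : 0 ≤ lapC φ z := by
  by_contra! hneg
  set k := -lapC φ z with hk
  have hk0 : 0 < k := by linarith
  have hnear : ∀ᶠ w in nhds z, lapC φ w < -(k / 2) ∧ φ w - τ < ψ w :=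
    ((continuous_lapC hφ).continuousAt.eventually (gt_mem_nhds (by linarith))).and
      ((isOpen_lt (hφ.continuous.sub continuous_const) h.continuous).mem_nhds
        (show φ z - τ < ψ z by linarith))
  obtain ⟨s, hs, hball⟩ := Metric.eventually_nhds_iff_ball.1 hnear
  set q : ℂ → ℝ := fun w => (w.re - z.re) ^ 2 + (w.im - z.im) ^ 2 with hq
  have hqd : ContDiff ℝ 2 q := contDiff_sqDist z
  have hb : ContDiff ℝ 2 (fun w => -φ w + -(k / 16) * q w) :=
    hφ.neg.add (contDiff_const.mul hqd)
  have := weak_max_principle (A := Metric.ball z s) (v := ψ)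
    (b := fun w => -φ w + -(k / 16) * q w) (m := -(k / 16) * s ^ 2) Metric.isOpen_ball
    Metric.isBounded_ball h.uniformContinuous (h.subh.mono fun w hw => (hball w hw).2) hb
    (fun w hw => ?_) (fun w hw => ?_) z (Metric.mem_ball_self hs)
  · simp only [hq, hz] at this
    have : 0 < k / 16 * s ^ 2 := by positivity
    nlinarith
  · rw [lapC_add hφ.neg (contDiff_const.mul hqd), lapC_neg, lapC_const_mul hqd, lapC_sqDist]
    linarith [(hball w hw).1]
  · rw [frontier_ball z hs.ne', Metric.mem_sphere] at hw
    have : q w = s ^ 2 := by rw [← hw]; exact sqDist_eq w z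
    rw [this]
    linarith [h.le_upper w]

theorem lapC_ne_zero_of_contact (h : IsOptimalWeight φ τ ψ) (hφ : ContDiff ℝ (⊤ : ℕ∞) φ)
    (hφp : PeriodicC φ) (hτ : 0 < τ) (hψ : Differentiable ℝ ψ) {K : NNReal}
    (hK : LipschitzWith K (fderiv ℝ ψ)) {p : ℂ} (hp : ψ p = φ p)
    (hnd : lapC φ p = 0 → fderiv ℝ (lapC φ) p ≠ 0) : lapC φ p ≠ 0 := by
  intro hp0
  have h2le : ∀ {f : ℂ → ℝ}, ContDiff ℝ (⊤ : ℕ∞) f → ContDiff ℝ 2 f := fun hf =>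
    hf.of_le (WithTop.coe_le_coe.2 le_top : ((2 : ℕ∞) : WithTop ℕ∞) ≤ (⊤ : ℕ∞))
  have hφ2 := h2le hφ
  have hlap2 := h2le (contDiff_lapC hφ)
  obtain ⟨M, hM⟩ := hφp.lapC.exists_lipschitzWith_fderiv hlap2
  obtain ⟨K', hK'⟩ := hφp.exists_lipschitzWith_fderiv hφ2
  have hφd : Differentiable ℝ φ := hφ2.differentiable (by norm_num)
  obtain ⟨s, hs, hball⟩ := Metric.isOpen_iff.1
    (isOpen_lt (hφ.continuous.sub continuous_const) h.continuous) p
    (show φ p - τ < ψ p by linarith)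
  obtain ⟨c, R, hR, hRs, hpc, hneg⟩ := exists_ball_subset_neg
    (hlap2.differentiable (by norm_num)) hM hp0 (hnd hp0) (by positivity : 0 < s / 3)
  have hgrow : ∀ w, φ w - ψ w ≤ (K' + K : NNReal) * dist w p ^ 2 := by
    refine le_mul_sq_dist_of_nonneg (g := fun w => φ w - ψ w) (hφd.sub hψ) ?_
      (fun w => sub_nonneg.2 (h.le_upper w)) (by rw [hp, sub_self])
    have : fderiv ℝ (fun w => φ w - ψ w) = fun w => fderiv ℝ φ w - fderiv ℝ ψ w :=
      funext fun w => fderiv_fun_sub (hφd w) (hψ w)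
    rw [this]
    exact hK'.sub hK
  set S : Set ℂ := Metric.sphere c (9 / 10 * R)
  have hcont : Continuous (fun w => φ w - ψ w) := hφ.continuous.sub h.continuous
  obtain ⟨m, hm, hmS⟩ := (isCompact_sphere c (9 / 10 * R)).exists_forall_le' (a := 0)
    hcont.continuousOn (fun w hw => by
      rw [Metric.mem_sphere] at hw
      have hwp : w ≠ p := by rintro rfl; linarith
      have hw0 := hneg w (by linarith) hwp
      refine sub_pos.2 (lt_of_le_of_ne (h.le_upper w) fun hc => ?_)
      linarith [h.lapC_nonneg_of_contact hφ2 hτ hc])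
  set η : ℝ := m / (3 * R ^ 2) with hηdef
  have hη : 0 < η := by positivity
  set A : Set ℂ := {w | 9 / 10 * R < dist w c ∧ dist w c < R} with hA
  have hdist : Continuous fun w : ℂ => dist w c := by fun_prop
  have hAo : IsOpen A :=
    (isOpen_lt continuous_const hdist).inter (isOpen_lt hdist continuous_const)
  have hAb : A ⊆ Metric.ball c R := fun w hw => hw.2
  have hAsub : A ⊆ {w | φ w - τ < ψ w} := by
    intro w hw
    refine hball ?_
    rw [Metric.mem_ball]
    have h1 := dist_triangle w c p
    rw [dist_comm c p, hpc] at h1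
    linarith [hw.2]
  have hbar := contDiff_hopfBarrier c R (n := 2)
  have key := weak_max_principle (A := A) (v := ψ)
    (b := fun w => -φ w + η * hopfBarrier c R w) (m := 0) hAo
    (Metric.isBounded_ball.subset hAb) h.uniformContinuous (h.subh.mono hAsub)
    (hφ2.neg.add (contDiff_const.mul hbar)) (fun w hw => ?_) (fun w hw => ?_)
  · set t : ℝ := min (1 / 20) (η / (2 * ((K' + K : NNReal) + 1))) with htdef
    have ht0 : 0 < t := by positivity
    have ht1 : t ≤ 1 / 20 := min_le_left _ _
    have ht2 : t * (2 * ((K' + K : NNReal) + 1)) ≤ η := by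
      rw [← le_div_iff₀ (by positivity)]
      exact min_le_right _ _
    set z : ℂ := c + (1 - t) • (p - c) with hzdef
    have hzc : dist z c = (1 - t) * R := by
      rw [hzdef, dist_eq_norm, add_sub_cancel_left, norm_smul, ← dist_eq_norm p c, hpc,
        Real.norm_of_nonneg (by linarith)]
    have hzp : dist z p = t * R := by
      have : z - p = -(t • (p - c)) := by
        rw [hzdef, sub_smul, one_smul]; ring
      rw [dist_eq_norm, this, norm_neg, norm_smul, ← dist_eq_norm p c, hpc,
        Real.norm_of_nonneg ht0.le]
    have hzA : z ∈ A := by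
      constructor
      · rw [hzc]; nlinarith
      · rw [hzc]; nlinarith
    have h1 := key z hzA
    have h2 := hgrow z
    have h3 := le_hopfBarrier hR hzA.2.le
    rw [hzp] at h2
    rw [hzc] at h3
    have h4 : η * (R * (R - (1 - t) * R)) ≤ (K' + K : NNReal) * (t * R) ^ 2 := by
      have := mul_le_mul_of_nonneg_left h3 hη.le
      linarith
    have h5 : η ≤ (K' + K : NNReal) * t := by
      have hp : 0 < t * R ^ 2 := by positivity
      refine le_of_mul_le_mul_right ?_ hp
      linarith
    have hKK := (K' + K : NNReal).coe_nonneg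
    nlinarith
  · have hwp : w ≠ p := by
      rintro rfl
      exact absurd hpc hw.2.ne
    rw [lapC_add hφ2.neg (contDiff_const.mul hbar), lapC_neg, lapC_const_mul hbar]
    have h1 := hneg w hw.2.le hwp
    have h2 := mul_pos hη (lapC_hopfBarrier_pos hR hw.1.le)
    linarith
  · rw [hAo.frontier_eq] at hw
    have hcl : 9 / 10 * R ≤ dist w c ∧ dist w c ≤ R := by
      have : closure A ⊆ {w | 9 / 10 * R ≤ dist w c ∧ dist w c ≤ R} :=
        closure_minimal (fun y hy => ⟨hy.1.le, hy.2.le⟩)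
          ((isClosed_le continuous_const hdist).inter (isClosed_le hdist continuous_const))
      exact this hw.1
    rcases hcl.2.lt_or_eq with hlt | heq
    · have h9 : dist w c = 9 / 10 * R := by
        refine le_antisymm ?_ hcl.1
        by_contra! hgt
        exact hw.2 ⟨hgt, hlt⟩
      have h1 := hmS w h9
      have h2 := mul_le_mul_of_nonneg_left (hopfBarrier_le hR hcl.2) hη.le
      have h3 : η * (3 * R ^ 2) = m := by rw [hηdef]; field_simp
      linarith
    · rw [hopfBarrier_eq_zero hR heq]
      linarith [h.le_upper w]

theorem lapC_pos_of_contact (h : IsOptimalWeight φ τ ψ) (hφ : ContDiff ℝ (⊤ : ℕ∞) φ)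
    (hφp : PeriodicC φ) (hτ : 0 < τ) (hψ : Differentiable ℝ ψ) {K : NNReal}
    (hK : LipschitzWith K (fderiv ℝ ψ))
    (hnd : ∀ z, lapC φ z = 0 → fderiv ℝ (lapC φ) z ≠ 0) {z : ℂ} (hz : ψ z = φ z) :
    0 < lapC φ z :=
  lt_of_le_of_ne
    (h.lapC_nonneg_of_contact
      (hφ.of_le (WithTop.coe_le_coe.2 le_top : ((2 : ℕ∞) : WithTop ℕ∞) ≤ (⊤ : ℕ∞))) hτ hz)
    (h.lapC_ne_zero_of_contact hφ hφp hτ hψ hK hz (hnd z)).symm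

end IsOptimalWeight

/-! ### The free boundaries are null sets -/

/-- A porous set is a null set. -/
theorem volume_eq_zero_of_porous {S : Set ℂ} (h : ∀ x ∈ S, ∃ κ > 0, ∃ r₀ > 0, ∀ r > 0, r < r₀ →
    ∃ y, dist x y ≤ 2 * r ∧ Disjoint S (Metric.closedBall y (κ * r))) : volume S = 0 := by
  have hae := ae_all_iff.2 fun n : ℕ =>
    IsUnifLocDoublingMeasure.ae_tendsto_measure_inter_div (volume : Measure ℂ) S n
  have hfalse : ∀ᵐ x ∂volume.restrict S, x ∉ S := by
    filter_upwards [hae] with x hx hxS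
    obtain ⟨κ, hκ, r₀, hr₀, hpor⟩ := h x hxS
    obtain ⟨n, hn⟩ := exists_nat_gt (2 / κ)
    have hseq : ∀ j : ℕ, 0 < r₀ / (j + 2) ∧ r₀ / (j + 2) < r₀ := fun j => by
      refine ⟨by positivity, div_lt_self hr₀ ?_⟩
      have : (0 : ℝ) ≤ j := j.cast_nonneg
      linarith
    choose y hy hdis using fun j : ℕ => hpor (r₀ / (j + 2)) (hseq j).1 (hseq j).2
    have hlim : Filter.Tendsto (fun j : ℕ => κ * (r₀ / ((j : ℝ) + 2))) Filter.atTop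
        (nhdsWithin 0 (Set.Ioi 0)) := by
      refine tendsto_nhdsWithin_iff.2 ⟨?_, Filter.Eventually.of_forall fun j =>
        mul_pos hκ (hseq j).1⟩
      have h1 : Filter.Tendsto (fun j : ℕ => (j : ℝ) + 2) Filter.atTop Filter.atTop :=
        Filter.tendsto_atTop_add_const_right _ _ tendsto_natCast_atTop_atTop
      simpa using (h1.const_div_atTop r₀).const_mul κ
    have h1 := hx n y _ hlim (Filter.Eventually.of_forall fun j => by
      refine (hy j).trans ?_
      rw [← mul_assoc]
      refine mul_le_mul_of_nonneg_right ?_ (hseq j).1.le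
      rw [div_lt_iff₀ hκ] at hn
      exact hn.le)
    have h0 : (fun j : ℕ => volume (S ∩ Metric.closedBall (y j) (κ * (r₀ / ((j : ℝ) + 2)))) /
        volume (Metric.closedBall (y j) (κ * (r₀ / ((j : ℝ) + 2))))) = fun _ => 0 := by
      funext j
      rw [(hdis j).inter_eq, measure_empty, ENNReal.zero_div]
    rw [h0] at h1
    exact zero_ne_one (tendsto_nhds_unique tendsto_const_nhds h1)
  rw [ae_iff] at hfalse
  simp only [not_not, Set.ofPred_mem_eq] at hfalse
  rwa [Measure.restrict_apply_self] at hfalse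

namespace IsOptimalWeight

variable {φ ψ : ℂ → ℝ} {τ : ℝ}

theorem isClosed_contact (h : IsOptimalWeight φ τ ψ) (hφ : Continuous φ) :
    IsClosed {z | ψ z = φ z} := isClosed_eq h.continuous hφ

/-- Quadratic nondegeneracy of the upper gap. -/
theorem exists_gap_gt (h : IsOptimalWeight φ τ ψ) (hφ : ContDiff ℝ 2 φ) {c r : ℝ} {z : ℂ}
    (hc : 0 < c) (hr : 0 < r) (hlap : ∀ w, dist w z < r → c ≤ lapC φ w) (hz : ψ z < φ z) :
    ∃ y, dist y z = r ∧ c / 8 * r ^ 2 < φ y - ψ y := by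
  by_contra! hcon
  set q : ℂ → ℝ := fun w => (w.re - z.re) ^ 2 + (w.im - z.im) ^ 2 with hq
  have hqd : ContDiff ℝ 2 q := contDiff_sqDist z
  set A : Set ℂ := Metric.ball z r ∩ {w | ψ w < φ w} with hA
  have hAo : IsOpen A := Metric.isOpen_ball.inter (isOpen_lt h.continuous hφ.continuous)
  have := weak_max_principle (A := A) (v := fun w => -ψ w)
    (b := fun w => φ w + -(c / 8) * q w) (m := 0) hAo
    (Metric.isBounded_ball.subset Set.inter_subset_left) h.uniformContinuous.neg
    (h.neg_subh.mono Set.inter_subset_right) (hφ.add (contDiff_const.mul hqd))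
    (fun w hw => ?_) (fun w hw => ?_) z ⟨Metric.mem_ball_self hr, hz⟩
  · simp only [hq] at this
    linarith
  · rw [lapC_add hφ (contDiff_const.mul hqd), lapC_const_mul hqd, lapC_sqDist]
    linarith [hlap w hw.1]
  · rw [hAo.frontier_eq] at hw
    have hcl : dist w z ≤ r := by
      have := closure_mono (Set.inter_subset_left : A ⊆ Metric.ball z r) hw.1
      exact Metric.closure_ball_subset_closedBall this
    have hqe : q w = dist w z ^ 2 := sqDist_eq w z
    rcases hcl.lt_or_eq with hlt | heq
    · have h1 : ¬ ψ w < φ w := fun h1 => hw.2 ⟨hlt, h1⟩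
      have h2 : 0 ≤ c / 8 * q w := by rw [hqe]; positivity
      linarith
    · have := hcon w heq
      rw [hqe, heq]
      linarith

theorem volume_frontier_contact (h : IsOptimalWeight φ τ ψ) (hφ : ContDiff ℝ 2 φ)
    (hφp : PeriodicC φ) (hψ : Differentiable ℝ ψ) {K : NNReal}
    (hK : LipschitzWith K (fderiv ℝ ψ)) (hpos : ∀ z, ψ z = φ z → 0 < lapC φ z) :
    volume (frontier {z | ψ z = φ z}) = 0 := by
  obtain ⟨K', hK'⟩ := hφp.exists_lipschitzWith_fderiv hφ
  have hφd : Differentiable ℝ φ := hφ.differentiable (by norm_num)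
  have hgrow : ∀ p, ψ p = φ p → ∀ w, φ w - ψ w ≤ (K' + K : NNReal) * dist w p ^ 2 := by
    intro p hp
    refine le_mul_sq_dist_of_nonneg (g := fun w => φ w - ψ w) (hφd.sub hψ) ?_
      (fun w => sub_nonneg.2 (h.le_upper w)) (by rw [hp, sub_self])
    have : fderiv ℝ (fun w => φ w - ψ w) = fun w => fderiv ℝ φ w - fderiv ℝ ψ w :=
      funext fun w => fderiv_fun_sub (hφd w) (hψ w)
    rw [this]
    exact hK'.sub hK
  have hcl := h.isClosed_contact hφ.continuous
  refine volume_eq_zero_of_porous fun x hx => ?_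
  have hxM : ψ x = φ x := hcl.frontier_subset hx
  have hc := hpos x hxM
  set c := lapC φ x / 2 with hcdef
  have hc0 : 0 < c := by positivity
  obtain ⟨s, hs, hball⟩ := Metric.eventually_nhds_iff_ball.1
    ((continuous_lapC hφ).continuousAt.eventually (lt_mem_nhds (show c < lapC φ x by linarith)))
  set κ : ℝ := √(c / (8 * ((K' + K : NNReal) + 1))) with hκ
  have hκ0 : 0 < κ := by positivity
  have hκ2 : ((K' + K : NNReal) + 1) * κ ^ 2 = c / 8 := by
    rw [hκ, Real.sq_sqrt (by positivity)]
    have : ((K' + K : NNReal) : ℝ) + 1 ≠ 0 := by positivity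
    field_simp
  refine ⟨κ, hκ0, s / 2, by positivity, fun r hr hrs => ?_⟩
  obtain ⟨z, hz, hzx⟩ : ∃ z, ψ z < φ z ∧ dist x z < r := by
    rw [frontier_eq_closure_inter_closure] at hx
    obtain ⟨z, hz, hd⟩ := Metric.mem_closure_iff.1 hx.2 r hr
    exact ⟨z, lt_of_le_of_ne (h.le_upper z) hz, hd⟩
  obtain ⟨y, hyz, hy⟩ := h.exists_gap_gt hφ hc0 hr (fun w hw => (hball w (by
    rw [Metric.mem_ball]
    have := dist_triangle w z x
    rw [dist_comm z x] at this
    linarith)).le) hz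
  refine ⟨y, ?_, Set.disjoint_left.2 fun p hp hpy => ?_⟩
  · have := dist_triangle x z y
    rw [dist_comm z y] at this
    linarith
  · have h1 := hgrow p (hcl.frontier_subset hp) y
    rw [Metric.mem_closedBall, dist_comm] at hpy
    have h2 : dist y p ^ 2 ≤ (κ * r) ^ 2 := by gcongr
    have h3 := (K' + K : NNReal).coe_nonneg
    have h4 : ((K' + K : NNReal) : ℝ) * dist y p ^ 2 ≤ ((K' + K : NNReal) + 1) * (κ * r) ^ 2 := by
      gcongr
      linarith
    have h5 : ((K' + K : NNReal) + 1) * (κ * r) ^ 2 = c / 8 * r ^ 2 := by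
      rw [← hκ2]; ring
    linarith

end IsOptimalWeight

/-! ### Integration by parts -/

theorem integral_mul_fderiv_eq_neg {f g : ℂ → ℝ} (hf : ContDiff ℝ 1 f) (hg : ContDiff ℝ 1 g)
    (hgc : HasCompactSupport g) (e : ℂ) :
    ∫ z, f z * fderiv ℝ g z e = -∫ z, fderiv ℝ f z e * g z := by
  have hf' : Continuous fun z => fderiv ℝ f z e :=
    (hf.continuous_fderiv (by norm_num)).clm_apply continuous_const
  have hg' : Continuous fun z => fderiv ℝ g z e :=
    (hg.continuous_fderiv (by norm_num)).clm_apply continuous_const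
  refine integral_mul_fderiv_eq_neg_fderiv_mul_of_integrable ?_ ?_ ?_
    (fun z _ => hf.differentiable (by norm_num) z) (fun z _ => hg.differentiable (by norm_num) z)
  · exact (hf'.mul hg.continuous).integrable_of_hasCompactSupport hgc.mul_left
  · exact (hf.continuous.mul hg').integrable_of_hasCompactSupport
      (hgc.fderiv_apply (𝕜 := ℝ) e).mul_left
  · exact (hf.continuous.mul hg.continuous).integrable_of_hasCompactSupport hgc.mul_left

theorem integral_mul_lapC {u χ : ℂ → ℝ} (hu : ContDiff ℝ 2 u) (hχ : ContDiff ℝ 2 χ)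
    (hc : HasCompactSupport χ) : ∫ z, u z * lapC χ z = ∫ z, lapC u z * χ z := by
  have hd : ∀ {f : ℂ → ℝ}, ContDiff ℝ 2 f → ∀ e : ℂ, ContDiff ℝ 1 fun w => fderiv ℝ f w e :=
    fun hf e => (hf.fderiv_right le_rfl).clm_apply contDiff_const
  have hdd : ∀ {f : ℂ → ℝ}, ContDiff ℝ 2 f → ∀ e : ℂ,
      Continuous fun z => fderiv ℝ (fun w => fderiv ℝ f w e) z e := fun hf e =>
    ((hd hf e).continuous_fderiv (by norm_num)).clm_apply continuous_const
  have hce : ∀ e : ℂ, HasCompactSupport fun w => fderiv ℝ χ w e := fun e =>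
    hc.fderiv_apply (𝕜 := ℝ) e
  have key : ∀ e : ℂ, ∫ z, u z * fderiv ℝ (fun w => fderiv ℝ χ w e) z e =
      ∫ z, fderiv ℝ (fun w => fderiv ℝ u w e) z e * χ z := by
    intro e
    rw [integral_mul_fderiv_eq_neg (hu.of_le (by norm_num)) (hd hχ e) (hce e),
      integral_mul_fderiv_eq_neg (hd hu e) (hχ.of_le (by norm_num)) hc, neg_neg]
  have hi1 : ∀ e : ℂ, Integrable fun z => u z * fderiv ℝ (fun w => fderiv ℝ χ w e) z e := fun e =>
    (hu.continuous.mul (hdd hχ e)).integrable_of_hasCompactSupport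
      ((hce e).fderiv_apply (𝕜 := ℝ) e).mul_left
  have hi2 : ∀ e : ℂ, Integrable fun z => fderiv ℝ (fun w => fderiv ℝ u w e) z e * χ z := fun e =>
    ((hdd hu e).mul hχ.continuous).integrable_of_hasCompactSupport hc.mul_left
  simp only [lapC, mul_add, add_mul]
  rw [integral_add (hi1 1) (hi1 I), integral_add (hi2 1) (hi2 I), key, key]

theorem lapC_mol_eq_mol_lapC (ρ : ContDiffBump (0 : ℂ)) {u : ℂ → ℝ} (hu : ContDiff ℝ 2 u) (z : ℂ) :
    lapC (mol ρ u) z = mol ρ (lapC u) z := by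
  have hk : ContDiff ℝ 2 (fun w => ρ.normed volume (z - w)) :=
    ρ.contDiff_normed.comp (contDiff_const.sub contDiff_id)
  have hkc : HasCompactSupport (fun w => ρ.normed volume (z - w)) :=
    ρ.hasCompactSupport_normed.comp_homeomorph (Homeomorph.subLeft z)
  rw [lapC_mol ρ hu.continuous, integral_mul_lapC hu hk hkc, mol, kconv,
    ← integral_sub_left_eq_self _ volume z]
  simp [mul_comm]

theorem setIntegral_Efd {f : ℂ → ℝ} (hf : Continuous f) :
    ∫ z in Efd, f z =
      ∫ x in (0 : ℝ)..2 * π, ∫ y in (0 : ℝ)..2 * π, f (Complex.equivRealProdCLM.symm (x, y)) := by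
  have hpi : (0 : ℝ) ≤ 2 * π := by positivity
  have hEq : Efd = Complex.measurableEquivRealProd ⁻¹'
      (Set.Ico 0 (2 * π) ×ˢ Set.Ico 0 (2 * π)) := rfl
  have h1 := Complex.volume_preserving_equiv_real_prod.setIntegral_preimage_emb
    Complex.measurableEquivRealProd.measurableEmbedding
    (fun p => f (Complex.equivRealProdCLM.symm p)) (Set.Ico 0 (2 * π) ×ˢ Set.Ico 0 (2 * π))
  have h2 : ∀ z, f (Complex.equivRealProdCLM.symm (Complex.measurableEquivRealProd z)) = f z :=
    fun z => rfl
  simp only [h2] at h1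
  have hc : Continuous fun p : ℝ × ℝ => f (Complex.equivRealProdCLM.symm p) :=
    hf.comp Complex.equivRealProdCLM.symm.continuous
  rw [hEq, h1, Measure.volume_eq_prod, setIntegral_prod]
  · simp only [intervalIntegral.integral_of_le hpi, integral_Ico_eq_integral_Ioc]
  · refine IntegrableOn.mono_set ?_ (Set.prod_mono Set.Ico_subset_Icc_self Set.Ico_subset_Icc_self)
    exact hc.continuousOn.integrableOn_compact (isCompact_Icc.prod isCompact_Icc)

theorem PeriodicC.setIntegral_lapC {u : ℂ → ℝ} (hp : PeriodicC u) (hu : ContDiff ℝ 2 u) :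
    ∫ z in Efd, _root_.lapC u z = 0 := by
  rw [setIntegral_Efd (continuous_lapC hu)]
  set T := Complex.equivRealProdCLM.symm with hT
  have hd : ∀ e : ℂ, ContDiff ℝ 1 fun w => _root_.fderiv ℝ u w e := fun e =>
    (hu.fderiv_right le_rfl).clm_apply contDiff_const
  have hpe : ∀ e : ℂ, PeriodicC fun w => _root_.fderiv ℝ u w e := fun e =>
    hp.fderiv.comp fun A => A e
  have hD : ∀ (e : ℂ) (x : ℝ × ℝ), HasFDerivAt (fun p => _root_.fderiv ℝ u (T p) e)
      ((_root_.fderiv ℝ (fun w => _root_.fderiv ℝ u w e) (T x)).comp (T : ℝ × ℝ →L[ℝ] ℂ)) x :=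
    fun e x => ((hd e).differentiable (by norm_num) (T x)).hasFDerivAt.comp x T.hasFDerivAt
  have hc : ∀ e : ℂ, Continuous fun p => _root_.fderiv ℝ u (T p) e := fun e =>
    (hd e).continuous.comp T.continuous
  have hT1 : T (1, 0) = 1 := by apply Complex.ext <;> simp [hT]
  have hT2 : T (0, 1) = I := by apply Complex.ext <;> simp [hT]
  have hlap : ∀ x : ℝ × ℝ, _root_.lapC u (T x) =
      ((_root_.fderiv ℝ (fun w => _root_.fderiv ℝ u w 1) (T x)).comp (T : ℝ × ℝ →L[ℝ] ℂ)) (1, 0) +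
      ((_root_.fderiv ℝ (fun w => _root_.fderiv ℝ u w I) (T x)).comp (T : ℝ × ℝ →L[ℝ] ℂ))
        (0, 1) := by
    intro x
    simp [_root_.lapC, hT1, hT2]
  have hlapc : Continuous fun x => _root_.lapC u (T x) :=
    (continuous_lapC hu).comp T.continuous
  have key := integral2_divergence_prod_of_hasFDerivAt_off_countable
    (fun p => _root_.fderiv ℝ u (T p) 1) (fun p => _root_.fderiv ℝ u (T p) I) _ _
    0 0 (2 * π) (2 * π) ∅ Set.countable_empty (hc 1).continuousOn (hc I).continuousOn
    (fun x _ => hD 1 x) (fun x _ => hD I x) (by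
      simp only [← hlap]
      exact hlapc.continuousOn.integrableOn_compact (isCompact_uIcc.prod isCompact_uIcc))
  simp only [← hlap] at key
  rw [key]
  have hx : ∀ x : ℝ, T (x, 2 * π) = T (x, 0) + (2 * π : ℝ) * I := fun x => by
    apply Complex.ext <;> simp [hT]
  have hy : ∀ y : ℝ, T (2 * π, y) = T (0, y) + (2 * π : ℝ) := fun y => by
    apply Complex.ext <;> simp [hT]
  simp only [hx, hy, (hpe I _).2, (hpe 1 _).1]
  ring

/-! ### Balance and positive measure of the contact sets -/

theorem lapC_mol_eq_zero (ρ : ContDiffBump (0 : ℂ)) {v : ℂ → ℝ} (hv : Continuous v) {A : Set ℂ}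
    (h : DSubhOn v A) (h' : DSuphOn v A) {z : ℂ} (hz : Metric.closedBall z ρ.rOut ⊆ A) :
    lapC (mol ρ v) z = 0 := by
  refine le_antisymm ?_ (lapC_mol_nonneg ρ hv h hz)
  have h1 := lapC_mol_nonneg ρ (v := fun w => -v w) hv.neg h'.neg hz
  have h2 : mol ρ (fun w => -v w) = fun w => -mol ρ v w := funext fun w => mol_neg ρ w
  rw [h2, lapC_neg] at h1
  linarith

theorem abs_lapC_le {u : ℂ → ℝ} (hu : ContDiff ℝ 2 u) {K : ℝ} {z : ℂ}
    (hK : ‖fderiv ℝ (fderiv ℝ u) z‖ ≤ K) : |lapC u z| ≤ 2 * K := by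
  rw [lapC_eq_fderiv_fderiv hu.contDiffAt]
  have key : ∀ e : ℂ, ‖e‖ = 1 → |fderiv ℝ (fderiv ℝ u) z e e| ≤ K := by
    intro e he
    have h1 : ‖fderiv ℝ (fderiv ℝ u) z e e‖ ≤ ‖fderiv ℝ (fderiv ℝ u) z‖ * ‖e‖ * ‖e‖ :=
      ContinuousLinearMap.le_opNorm₂ _ _ _
    rw [he, mul_one, mul_one] at h1
    exact h1.trans hK
  calc _ ≤ |fderiv ℝ (fderiv ℝ u) z 1 1| + |fderiv ℝ (fderiv ℝ u) z I I| := abs_add_le _ _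
    _ ≤ 2 * K := by linarith [key 1 (by simp), key I (by simp)]

theorem tendsto_mol {ρ : ℕ → ContDiffBump (0 : ℂ)}
    (hρ : Filter.Tendsto (fun n => (ρ n).rOut) Filter.atTop (nhds 0)) {v : ℂ → ℝ}
    (hv : Continuous v) (z : ℂ) :
    Filter.Tendsto (fun n => mol (ρ n) v z) Filter.atTop (nhds (v z)) := by
  rw [Metric.tendsto_nhds]
  intro ε hε
  obtain ⟨δ, hδ, h⟩ := Metric.continuousAt_iff.1 (hv.continuousAt (x := z)) (ε / 2) (half_pos hε)
  filter_upwards [hρ.eventually (gt_mem_nhds hδ)] with n hn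
  refine (abs_mol_sub_le (ρ n) hv fun t ht => ?_).trans_lt (half_lt_self hε)
  exact (h (by simpa using ht.trans_lt hn)).le

theorem exists_mol_seq {r : ℝ} (hr : 0 < r) : ∃ ρ : ℕ → ContDiffBump (0 : ℂ),
    (∀ n, (ρ n).rOut ≤ r) ∧ Filter.Tendsto (fun n => (ρ n).rOut) Filter.atTop (nhds 0) := by
  choose ρ hρ using fun n : ℕ => exists_bump (show 0 < r / ((n : ℝ) + 1) by positivity)
  refine ⟨ρ, fun n => ?_, ?_⟩
  · rw [hρ]
    exact div_le_self hr.le (by linarith [(n.cast_nonneg : (0 : ℝ) ≤ n)])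
  · simp only [hρ]
    exact (Filter.tendsto_atTop_add_const_right _ 1 tendsto_natCast_atTop_atTop).const_div_atTop r

theorem measurableSet_Efd : MeasurableSet Efd :=
  (measurableSet_Ico.preimage Complex.measurable_re).inter
    (measurableSet_Ico.preimage Complex.measurable_im)

theorem tendsto_lapC_mol_of_eventuallyEq {ρ : ℕ → ContDiffBump (0 : ℂ)}
    (hρ : Filter.Tendsto (fun n => (ρ n).rOut) Filter.atTop (nhds 0)) {u v : ℂ → ℝ}
    (hu : ContDiff ℝ 2 u) {z : ℂ} (huv : v =ᶠ[nhds z] u) :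
    Filter.Tendsto (fun n => lapC (mol (ρ n) v) z) Filter.atTop (nhds (lapC u z)) := by
  obtain ⟨s, hs, hball⟩ := Metric.eventually_nhds_iff_ball.1 huv
  refine (tendsto_mol hρ (continuous_lapC hu) z).congr' ?_
  filter_upwards [hρ.eventually (gt_mem_nhds (half_pos hs))] with n hn
  rw [← lapC_mol_eq_mol_lapC _ hu]
  refine (lapC_congr_of_eventuallyEq ?_).symm
  filter_upwards [Metric.ball_mem_nhds z (half_pos hs)] with w hw
  refine mol_congr _ fun t ht => hball _ ?_
  rw [Metric.mem_ball] at hw ⊢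
  have h1 := dist_triangle (w - t) w z
  rw [dist_self_sub_left] at h1
  linarith

namespace IsOptimalWeight

variable {φ ψ : ℂ → ℝ} {τ : ℝ}

theorem isClosed_lower_contact (h : IsOptimalWeight φ τ ψ) (hφ : Continuous φ) :
    IsClosed {z | ψ z = φ z - τ} := isClosed_eq h.continuous (hφ.sub continuous_const)

theorem ae_tendsto_lapC_mol (h : IsOptimalWeight φ τ ψ) (hφ : ContDiff ℝ 2 φ)
    (hup : volume (frontier {z | ψ z = φ z}) = 0)
    (hlo : volume (frontier {z | ψ z = φ z - τ}) = 0) {ρ : ℕ → ContDiffBump (0 : ℂ)}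
    (hρ : Filter.Tendsto (fun n => (ρ n).rOut) Filter.atTop (nhds 0)) :
    ∀ᵐ z, Filter.Tendsto (fun n => lapC (mol (ρ n) ψ) z) Filter.atTop
      (nhds (({z | ψ z = φ z} ∪ {z | ψ z = φ z - τ}).indicator (lapC φ) z)) := by
  filter_upwards [measure_eq_zero_iff_ae_notMem.1 hup, measure_eq_zero_iff_ae_notMem.1 hlo]
    with z hz1 hz2
  by_cases hu : ψ z = φ z
  · rw [Set.indicator_of_mem (Set.mem_union_left _ (show z ∈ {z | ψ z = φ z} from hu))]
    refine tendsto_lapC_mol_of_eventuallyEq hρ hφ ?_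
    rw [(h.isClosed_contact hφ.continuous).frontier_eq] at hz1
    have : z ∈ interior {z | ψ z = φ z} := by
      by_contra hn
      exact hz1 ⟨hu, hn⟩
    exact mem_interior_iff_mem_nhds.1 this
  by_cases hl : ψ z = φ z - τ
  · rw [Set.indicator_of_mem (Set.mem_union_right _ (show z ∈ {z | ψ z = φ z - τ} from hl))]
    have hlap : lapC φ z = lapC (fun w => φ w - τ) z := by
      simp [lapC, fderiv_sub_const]
    rw [hlap]
    refine tendsto_lapC_mol_of_eventuallyEq hρ (hφ.sub contDiff_const) ?_
    rw [(h.isClosed_lower_contact hφ.continuous).frontier_eq] at hz2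
    have : z ∈ interior {z | ψ z = φ z - τ} := by
      by_contra hn
      exact hz2 ⟨hl, hn⟩
    exact mem_interior_iff_mem_nhds.1 this
  · rw [Set.indicator_of_notMem (fun hz => hz.elim hu hl)]
    refine tendsto_const_nhds.congr' ?_
    set A : Set ℂ := {w | φ w - τ < ψ w} ∩ {w | ψ w < φ w}
    have hA : IsOpen A := (isOpen_lt (hφ.continuous.sub continuous_const) h.continuous).inter
      (isOpen_lt h.continuous hφ.continuous)
    have hzA : z ∈ A :=
      ⟨lt_of_le_of_ne (h.lower_le z) (Ne.symm hl), lt_of_le_of_ne (h.le_upper z) hu⟩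
    obtain ⟨s, hs, hball⟩ := Metric.isOpen_iff.1 hA z hzA
    filter_upwards [hρ.eventually (gt_mem_nhds hs)] with n hn
    exact (lapC_mol_eq_zero _ h.continuous (h.subh.mono Set.inter_subset_left)
      (fun χ h1 h2 h3 h4 => h.suph χ h1 h2 h3 (h4.trans Set.inter_subset_right))
      ((Metric.closedBall_subset_ball hn).trans hball)).symm

theorem setIntegral_contact_add (h : IsOptimalWeight φ τ ψ) (hφ : ContDiff ℝ 2 φ) (hτ : 0 < τ)
    (hup : volume (frontier {z | ψ z = φ z}) = 0)
    (hlo : volume (frontier {z | ψ z = φ z - τ}) = 0) {K r : ℝ} (hr : 0 < r)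
    (hK : ∀ ρ : ContDiffBump (0 : ℂ), ρ.rOut ≤ r →
      ∀ z, ‖fderiv ℝ (fderiv ℝ (mol ρ ψ)) z‖ ≤ K) :
    (∫ z in {z | ψ z = φ z} ∩ Efd, lapC φ z) + ∫ z in {z | ψ z = φ z - τ} ∩ Efd, lapC φ z = 0 := by
  obtain ⟨ρ, hρr, hρ⟩ := exists_mol_seq hr
  have hfin : volume Efd < ⊤ :=
    (measure_mono Efd_subset_closedSquare).trans_lt isCompact_closedSquare.measure_lt_top
  have hm1 := (h.isClosed_contact hφ.continuous).measurableSet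
  have hm2 := (h.isClosed_lower_contact hφ.continuous).measurableSet
  have hlim : Filter.Tendsto (fun n => ∫ z in Efd, lapC (mol (ρ n) ψ) z) Filter.atTop
      (nhds (∫ z in Efd, ({z | ψ z = φ z} ∪ {z | ψ z = φ z - τ}).indicator (lapC φ) z)) := by
    refine tendsto_integral_of_dominated_convergence (fun _ => 2 * K) (fun n =>
      (continuous_lapC (contDiff_two_mol (ρ n) h.continuous)).aestronglyMeasurable) ?_ ?_
      (ae_restrict_of_ae (h.ae_tendsto_lapC_mol hφ hup hlo hρ))
    · exact integrableOn_const hfin.ne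
    · exact fun n => Filter.Eventually.of_forall fun z =>
        abs_lapC_le (contDiff_two_mol (ρ n) h.continuous) (hK (ρ n) (hρr n) z)
  have hzero : ∀ n, ∫ z in Efd, lapC (mol (ρ n) ψ) z = 0 := fun n =>
    (periodicC_mol (ρ n) h.periodic).setIntegral_lapC (contDiff_two_mol (ρ n) h.continuous)
  simp only [hzero] at hlim
  have hlapφ : IntegrableOn (lapC φ) Efd :=
    ((continuous_lapC hφ).continuousOn.integrableOn_compact isCompact_closedSquare).mono_set
      Efd_subset_closedSquare
  rw [setIntegral_indicator (hm1.union hm2), Set.inter_union_distrib_left, Set.inter_comm Efd,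
    Set.inter_comm Efd, setIntegral_union] at hlim
  · exact (tendsto_nhds_unique tendsto_const_nhds hlim).symm
  · refine Set.disjoint_left.2 fun z hz hz' => ?_
    have h1 : ψ z = φ z := hz.1
    have h2 : ψ z = φ z - τ := hz'.1
    linarith
  · exact hm2.inter measurableSet_Efd
  · exact hlapφ.mono_set Set.inter_subset_right
  · exact hlapφ.mono_set Set.inter_subset_right

theorem integral_mul_lapC_eq (h : IsOptimalWeight φ τ ψ) (hφ : ContDiff ℝ 2 φ)
    (hup : volume (frontier {z | ψ z = φ z}) = 0)
    (hlo : volume (frontier {z | ψ z = φ z - τ}) = 0) {K r : ℝ} (hr : 0 < r)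
    (hK : ∀ ρ : ContDiffBump (0 : ℂ), ρ.rOut ≤ r →
      ∀ z, ‖fderiv ℝ (fderiv ℝ (mol ρ ψ)) z‖ ≤ K) {χ : ℂ → ℝ} (hχ : ContDiff ℝ (⊤ : ℕ∞) χ)
    (hχc : HasCompactSupport χ) :
    ∫ z, ψ z * lapC χ z =
      ∫ z, ({z | ψ z = φ z} ∪ {z | ψ z = φ z - τ}).indicator (lapC φ) z * χ z := by
  obtain ⟨ρ, hρr, hρ⟩ := exists_mol_seq hr
  obtain ⟨C, -, hC⟩ := PeriodicC.exists_bound h.continuous h.periodic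
  have hχ2 : ContDiff ℝ 2 χ :=
    hχ.of_le (WithTop.coe_le_coe.2 le_top : ((2 : ℕ∞) : WithTop ℕ∞) ≤ (⊤ : ℕ∞))
  have hl := integrable_mul_lapC (v := fun _ => (1 : ℝ)) continuous_const hχ hχc
  simp only [one_mul] at hl
  have h1 : Filter.Tendsto (fun n => ∫ z, mol (ρ n) ψ z * lapC χ z) Filter.atTop
      (nhds (∫ z, ψ z * lapC χ z)) := by
    refine tendsto_integral_of_dominated_convergence (fun z => C * ‖lapC χ z‖) (fun n =>
      ((contDiff_two_mol (ρ n) h.continuous).continuous.mul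
        (continuous_lapC hχ2)).aestronglyMeasurable) (hl.norm.const_mul C) (fun n => ?_)
      (Filter.Eventually.of_forall fun z => (tendsto_mol hρ h.continuous z).mul_const _)
    refine Filter.Eventually.of_forall fun z => ?_
    rw [norm_mul]
    refine mul_le_mul_of_nonneg_right (abs_le.2 ⟨?_, ?_⟩) (norm_nonneg _)
    · exact le_mol _ h.continuous fun t _ => (abs_le.1 (hC _)).1
    · exact mol_le _ h.continuous fun t _ => (abs_le.1 (hC _)).2
  have h2 : Filter.Tendsto (fun n => ∫ z, lapC (mol (ρ n) ψ) z * χ z) Filter.atTop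
      (nhds (∫ z, ({z | ψ z = φ z} ∪ {z | ψ z = φ z - τ}).indicator (lapC φ) z * χ z)) := by
    refine tendsto_integral_of_dominated_convergence (fun z => 2 * K * ‖χ z‖) (fun n =>
      ((continuous_lapC (contDiff_two_mol (ρ n) h.continuous)).mul
        hχ.continuous).aestronglyMeasurable)
      ((hχ.continuous.integrable_of_hasCompactSupport hχc).norm.const_mul _) (fun n => ?_) ?_
    · refine Filter.Eventually.of_forall fun z => ?_
      rw [norm_mul]
      exact mul_le_mul_of_nonneg_right (abs_lapC_le (contDiff_two_mol (ρ n) h.continuous)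
        (hK (ρ n) (hρr n) z)) (norm_nonneg _)
    · filter_upwards [h.ae_tendsto_lapC_mol hφ hup hlo hρ] with z hz using hz.mul_const _
  simp only [integral_mul_lapC (contDiff_two_mol _ h.continuous) hχ2 hχc] at h1
  exact tendsto_nhds_unique h1 h2

end IsOptimalWeight

theorem PeriodicC.volume_eq_zero {S : Set ℂ} (hS : PeriodicC fun z => z ∈ S)
    (h0 : volume (S ∩ Efd) = 0) : volume S = 0 := by
  have hcover : S ⊆ ⋃ p : ℤ × ℤ, (fun z : ℂ => z + (p.1 * ((2 * π : ℝ) : ℂ) +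
      p.2 * ((2 * π : ℝ) * I))) ⁻¹' (S ∩ Efd) := fun z hz =>
    Set.mem_iUnion.2 ⟨(-⌊z.re / (2 * π)⌋, -⌊z.im / (2 * π)⌋),
      (hS.add_latticeShift z z).mpr hz, add_latticeShift_mem z⟩
  refine measure_mono_null hcover (measure_iUnion_null fun p => ?_)
  rw [measure_preimage_add_right]
  exact h0

namespace IsOptimalWeight

variable {φ ψ : ℂ → ℝ} {τ : ℝ}

theorem volume_contact_pos (h : IsOptimalWeight φ τ ψ) (hφ : ContDiff ℝ 2 φ) (hφp : PeriodicC φ)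
    (hosc : ∀ c, ¬ ∀ z, φ z - τ ≤ c ∧ c ≤ φ z)
    (hneg : ∀ z, ψ z = φ z - τ → lapC φ z < 0)
    (hup : volume (frontier {z | ψ z = φ z}) = 0)
    (hlo : volume (frontier {z | ψ z = φ z - τ}) = 0) {K r : ℝ} (hr : 0 < r)
    (hK : ∀ ρ : ContDiffBump (0 : ℂ), ρ.rOut ≤ r →
      ∀ z, ‖fderiv ℝ (fderiv ℝ (mol ρ ψ)) z‖ ≤ K) :
    0 < volume ({z | ψ z = φ z} ∩ Efd) := by
  refine pos_iff_ne_zero.2 fun h0 => ?_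
  have hM : volume {z | ψ z = φ z} = 0 :=
    PeriodicC.volume_eq_zero (h.periodic.comp₂ hφp fun a b => a = b) h0
  have hsup : DSuphOn ψ Set.univ := by
    intro χ hχ hχc hχ0 _
    rw [h.integral_mul_lapC_eq hφ hup hlo hr hK hχ hχc]
    refine integral_nonpos_of_ae ?_
    filter_upwards [measure_eq_zero_iff_ae_notMem.1 hM] with z hz
    refine mul_nonpos_of_nonpos_of_nonneg ?_ (hχ0 z)
    by_cases hl : ψ z = φ z - τ
    · rw [Set.indicator_of_mem (Set.mem_union_right _ (show z ∈ {z | ψ z = φ z - τ} from hl))]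
      exact (hneg z hl).le
    · rw [Set.indicator_of_notMem fun hz' => hz'.elim hz hl]
  obtain ⟨c, hc⟩ := DSubhOn.const_of_periodic (v := fun z => -ψ z) h.continuous.neg
    (h.periodic.comp _) hsup.neg
  refine hosc (-c) fun z => ?_
  rw [← hc z, neg_neg]
  exact ⟨h.lower_le z, h.le_upper z⟩

end IsOptimalWeight

/-! ### The theorem -/

theorem osc_of_lt_sSup_sub_sInf {φ : ℂ → ℝ} {τ : ℝ} (hτ : τ < sSup (φ '' Efd) - sInf (φ '' Efd))
    (c : ℝ) : ¬ ∀ z, φ z - τ ≤ c ∧ c ≤ φ z := by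
  intro hc
  have hne : (φ '' Efd).Nonempty := ⟨_, 0 + latticeShift 0, add_latticeShift_mem 0, rfl⟩
  have h1 : sSup (φ '' Efd) ≤ c + τ := csSup_le hne (by
    rintro _ ⟨z, -, rfl⟩
    linarith [(hc z).1])
  have h2 : c ≤ sInf (φ '' Efd) := le_csInf hne (by
    rintro _ ⟨z, -, rfl⟩
    exact (hc z).2)
  linarith

/-- **Theorem (existence, uniqueness, regularity and structure of the optimal weight,
i.e. of the solution of the double obstacle problem on the torus).** -/
theorem optimal_weight_exists_unique
    (φ : ℂ → ℝ) (τ : ℝ)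
    (hφ : ContDiff ℝ (⊤ : ℕ∞) φ) (hφp : PeriodicC φ) (hφnc : ∃ z w : ℂ, φ z ≠ φ w)
    (hτ0 : 0 < τ) (hτ : τ < sSup (φ '' Efd) - sInf (φ '' Efd))
    (hnd : ∀ z : ℂ, lapC φ z = 0 → fderiv ℝ (lapC φ) z ≠ 0) :
    ∃ ψ : ℂ → ℝ,
      -- ψ is an optimal weight:
      (Continuous ψ ∧ PeriodicC ψ ∧ (∀ z, φ z - τ ≤ ψ z ∧ ψ z ≤ φ z) ∧
        DSubhOn ψ {z | φ z - τ < ψ z} ∧ DSuphOn ψ {z | ψ z < φ z}) ∧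
      -- uniqueness:
      (∀ ψ' : ℂ → ℝ,
        (Continuous ψ' ∧ PeriodicC ψ' ∧ (∀ z, φ z - τ ≤ ψ' z ∧ ψ' z ≤ φ z) ∧
          DSubhOn ψ' {z | φ z - τ < ψ' z} ∧ DSuphOn ψ' {z | ψ' z < φ z}) → ψ' = ψ) ∧
      -- C^{1,1} regularity:
      (ContDiff ℝ 1 ψ ∧ ∃ K : NNReal, LipschitzWith K (fderiv ℝ ψ)) ∧
      -- the contact sets have positive measure:
      0 < volume ({z | ψ z = φ z} ∩ Efd) ∧
      0 < volume ({z | ψ z = φ z - τ} ∩ Efd) ∧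
      -- location of the contact sets:
      {z | ψ z = φ z} ⊆ {z | 0 < lapC φ z} ∧
      {z | ψ z = φ z - τ} ⊆ {z | lapC φ z < 0} ∧
      -- balance of the integrals:
      (∫ z in {z | ψ z = φ z} ∩ Efd, lapC φ z) =
        -∫ z in {z | ψ z = φ z - τ} ∩ Efd, lapC φ z ∧
      -- the free boundaries have measure zero:
      volume (frontier {z | ψ z = φ z}) = 0 ∧
      volume (frontier {z | ψ z = φ z - τ}) = 0 := by
  have hφ2 : ContDiff ℝ 2 φ :=
    hφ.of_le (WithTop.coe_le_coe.2 le_top : ((2 : ℕ∞) : WithTop ℕ∞) ≤ (⊤ : ℕ∞))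
  have hosc := osc_of_lt_sSup_sub_sInf hτ
  obtain ⟨L, hL⟩ := hφp.exists_lipschitzWith (hφ2.of_le (by norm_num))
  obtain ⟨ψ, h, hψL⟩ := exists_isOptimalWeight hL hφp hτ0
  obtain ⟨K, r, hr, hK⟩ := h.exists_norm_fderiv_fderiv_mol_le hψL hL hφ2 hφp hτ0 hosc
  obtain ⟨hψ, hψK⟩ := lipschitzWith_fderiv_of_mol hψL hr hK
  have hpos : ∀ z, ψ z = φ z → 0 < lapC φ z := fun z hz =>
    h.lapC_pos_of_contact hφ hφp hτ0 hψ hψK hnd hz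
  have hup := h.volume_frontier_contact hφ2 hφp hψ hψK hpos
  -- the lower contact set is the upper contact set of the reflected problem
  set φ' : ℂ → ℝ := fun z => τ - φ z with hφ'
  set ψ' : ℂ → ℝ := fun z => -ψ z with hψ'
  have h' : IsOptimalWeight φ' τ ψ' := h.neg
  have hφ's : ContDiff ℝ (⊤ : ℕ∞) φ' := contDiff_const.sub hφ
  have hφ'2 : ContDiff ℝ 2 φ' := contDiff_const.sub hφ2
  have hφ'p : PeriodicC φ' := hφp.comp fun t => τ - t
  have hlap : lapC φ' = fun z => -lapC φ z := by
    funext z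
    simp [lapC, hφ', fderiv_const_sub]
    ring
  have hfd : fderiv ℝ ψ' = fun z => -fderiv ℝ ψ z := funext fun z => fderiv_fun_neg
  have hψ'K : LipschitzWith K (fderiv ℝ ψ') := by
    rw [hfd]
    exact hψK.neg
  have hnd' : ∀ z, lapC φ' z = 0 → fderiv ℝ (lapC φ') z ≠ 0 := by
    intro z hz
    rw [hlap] at hz ⊢
    rw [fderiv_fun_neg]
    exact neg_ne_zero.2 (hnd z (neg_eq_zero.1 hz))
  have hK' : ∀ ρ : ContDiffBump (0 : ℂ), ρ.rOut ≤ r →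
      ∀ z, ‖fderiv ℝ (fderiv ℝ (mol ρ ψ')) z‖ ≤ K := by
    intro ρ hρ z
    have h1 : fderiv ℝ (mol ρ ψ') = fun w => -fderiv ℝ (mol ρ ψ) w := by
      have : mol ρ ψ' = fun w => -mol ρ ψ w := funext fun w => mol_neg ρ w
      rw [this]
      exact funext fun w => fderiv_fun_neg
    rw [h1, fderiv_fun_neg, ContinuousLinearMap.opNorm_neg]
    exact hK ρ hρ z
  have hS : {z | ψ' z = φ' z} = {z | ψ z = φ z - τ} := by
    ext z
    simp only [hψ', hφ', Set.mem_ofPred_eq]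
    constructor <;> intro hz <;> linarith
  have hS' : {z | ψ' z = φ' z - τ} = {z | ψ z = φ z} := by
    ext z
    simp only [hψ', hφ', Set.mem_ofPred_eq]
    constructor <;> intro hz <;> linarith
  have hpos' : ∀ z, ψ' z = φ' z → 0 < lapC φ' z := fun z hz =>
    h'.lapC_pos_of_contact hφ's hφ'p hτ0 hψ.neg hψ'K hnd' hz
  have hneg : ∀ z, ψ z = φ z - τ → lapC φ z < 0 := by
    intro z hz
    have h1 := hpos' z (by simp only [hψ', hφ']; linarith)
    rw [hlap] at h1
    linarith
  have hlo' := h'.volume_frontier_contact hφ'2 hφ'p hψ.neg hψ'K hpos'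
  have hlo : volume (frontier {z | ψ z = φ z - τ}) = 0 := hS ▸ hlo'
  have hup' : volume (frontier {z | ψ' z = φ' z - τ}) = 0 := by rw [hS']; exact hup
  have hvol' := h'.volume_contact_pos hφ'2 hφ'p (IsOptimalWeight.osc_neg hosc) (fun z hz => by
    rw [hlap]
    have := hpos z (by simp only [hψ', hφ'] at hz; linarith)
    linarith) hlo' hup' hr hK'
  rw [hS] at hvol'
  refine ⟨ψ, h, fun ψ'' h'' => h.unique h'' hosc, ⟨?_, K, hψK⟩,
    h.volume_contact_pos hφ2 hφp hosc hneg hup hlo hr hK, hvol', hpos, hneg, ?_, hup, hlo⟩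
  · exact contDiff_one_iff_fderiv.2 ⟨hψ, hψK.continuous⟩
  · exact eq_neg_of_add_eq_zero_left (h.setIntegral_contact_add hφ2 hτ0 hup hlo hr hK)
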